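/- For every B ⊆ ℕ the following are equivalent: (1) B is uniformly almost everywhere dominating; (2) B is almost everywhere dominating; (3) B is positive measure dominating; (4) ∅′ ≤_LR B. -/

import Mathlib

open MeasureTheory Filter

namespace LMD

/-- Codes for partial functions recursive in an oracle. -/
inductive OracleCode : Type
  | zero : OracleCode
  | succ : OracleCode
  | left : OracleCode
  | right : OracleCode
  | oracle : OracleCode
  | pair : OracleCode → OracleCode → OracleCode
  | comp : OracleCode → OracleCode → OracleCode
  | prec : OracleCode → OracleCode → OracleCode
  | rfind' : OracleCode → OracleCode

namespace OracleCode

/-- Evaluation of an oracle code relative to a (total) oracle `O : ℕ → ℕ`. -/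
def eval (O : ℕ → ℕ) : OracleCode → ℕ →. ℕ
  | zero => pure 0
  | succ => Nat.succ
  | left => ↑fun n : ℕ => n.unpair.1
  | right => ↑fun n : ℕ => n.unpair.2
  | oracle => ↑fun n : ℕ => O n
  | pair cf cg => fun n => Nat.pair <$> eval O cf n <*> eval O cg n
  | comp cf cg => fun n => eval O cg n >>= eval O cf
  | prec cf cg =>
    Nat.unpaired fun a n =>
      n.rec (eval O cf a) fun y IH => do
        let i ← IH
        eval O cg (Nat.pair a (Nat.pair y i))
  | rfind' cf =>
    Nat.unpaired fun a m =>
      (Nat.rfind fun n => (fun m => m = 0) <$> eval O cf (Nat.pair a (n + m))).map (· + m)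

/-- A Gödel numbering of oracle codes. -/
def encodeCode : OracleCode → ℕ
  | zero => 0
  | succ => 1
  | left => 2
  | right => 3
  | oracle => 4
  | pair cf cg => 4 * Nat.pair (encodeCode cf) (encodeCode cg) + 5
  | comp cf cg => 4 * Nat.pair (encodeCode cf) (encodeCode cg) + 6
  | prec cf cg => 4 * Nat.pair (encodeCode cf) (encodeCode cg) + 7
  | rfind' cf => 4 * encodeCode cf + 8

end OracleCode

/-- `f` is partial recursive in the oracle `O`. -/
def RecursiveIn (O : ℕ → ℕ) (f : ℕ →. ℕ) : Prop := ∃ c : OracleCode, c.eval O = f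

/-- The characteristic function of a set of naturals. -/
noncomputable def chi (A : Set ℕ) : ℕ → ℕ := A.indicator fun _ => 1

/-- Turing reducibility between sets of naturals. -/
def TuringLE (A B : Set ℕ) : Prop := RecursiveIn (chi B) (chi A)

/-- The Turing jump of a set of naturals. -/
def jump (B : Set ℕ) : Set ℕ :=
  {e | ∃ c : OracleCode, c.encodeCode = e ∧ (c.eval (chi B) e).Dom}

/-- The open subset of Cantor space generated by a set of finite binary strings. -/
def Cyl (W : Set (List Bool)) : Set (ℕ → Bool) :=
  {X | ∃ σ ∈ W, ∀ i : Fin σ.length, X i = σ.get i}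

/-- The fair-coin product measure on Cantor space, realized as the pushforward of
Lebesgue measure on `[0,1)` under the binary expansion map. -/
noncomputable def mu : Measure (ℕ → Bool) :=
  Measure.map (fun x n => decide (⌊x * 2 ^ (n + 1)⌋₊ % 2 = 1))
    (volume.restrict (Set.Ico (0 : ℝ) 1))

/-- `W` is a c.e.-in-`A` set of binary strings. -/
def CeIn (A : Set ℕ) (W : Set (List Bool)) : Prop :=
  ∃ c : OracleCode, ∀ σ : List Bool, σ ∈ W ↔ (c.eval (chi A) (Encodable.encode σ)).Dom

/-- `W` is a uniformly c.e.-in-`A` sequence of sets of binary strings. -/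
def CeSeqIn (A : Set ℕ) (W : ℕ → Set (List Bool)) : Prop :=
  ∃ c : OracleCode, ∀ (n : ℕ) (σ : List Bool),
    σ ∈ W n ↔ (c.eval (chi A) (Nat.pair n (Encodable.encode σ))).Dom

/-- A Martin-Löf test relative to `A`. -/
def MLTest (A : Set ℕ) (U : ℕ → Set (ℕ → Bool)) : Prop :=
  ∃ W : ℕ → Set (List Bool), CeSeqIn A W ∧ (∀ n, U n = Cyl (W n)) ∧
    (∀ n, U (n + 1) ⊆ U n) ∧ ∀ n, mu (U n) ≤ 2⁻¹ ^ n

/-- `X` is Martin-Löf random relative to `A`. -/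
def MLRandom (A : Set ℕ) (X : ℕ → Bool) : Prop :=
  ∀ U : ℕ → Set (ℕ → Bool), MLTest A U → X ∉ ⋂ n, U n

/-- `A ≤_LR B`: every `B`-random is `A`-random. -/
def LRle (A B : Set ℕ) : Prop := ∀ X : ℕ → Bool, MLRandom B X → MLRandom A X

/-- Evaluation of an oracle machine on binary strings. -/
def evalStr (c : OracleCode) (O : ℕ → ℕ) (σ : List Bool) : Part (List Bool) :=
  (c.eval O (Encodable.encode σ)).bind fun m => Part.ofOption (Encodable.decode m)

/-- `c` is a prefix-free oracle machine: for every oracle its domain is prefix-free. -/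
def PrefixFreeMachine (c : OracleCode) : Prop :=
  ∀ (O : ℕ → ℕ) (σ₁ σ₂ : List Bool), σ₁ <+: σ₂ →
    (evalStr c O σ₁).Dom → (evalStr c O σ₂).Dom → σ₁ = σ₂

/-- `u` is a universal prefix-free oracle machine. -/
def UniversalPFM (u : OracleCode) : Prop :=
  PrefixFreeMachine u ∧
    ∀ c : OracleCode, PrefixFreeMachine c → ∃ d : ℕ, ∀ (O : ℕ → ℕ) (σ τ : List Bool),
      τ ∈ evalStr c O σ → ∃ σ' : List Bool, τ ∈ evalStr u O σ' ∧ σ'.length ≤ σ.length + d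

/-- Prefix-free Kolmogorov complexity relative to the oracle `O`,
measured by the universal machine `u` (`⊤` if `τ` is not in the range). -/
noncomputable def K (u : OracleCode) (O : ℕ → ℕ) (τ : List Bool) : ℕ∞ :=
  ⨅ σ ∈ {σ : List Bool | τ ∈ evalStr u O σ}, (σ.length : ℕ∞)

/-- `A ≤_LK B` with respect to the universal machine `u`. -/
def LKle (u : OracleCode) (A B : Set ℕ) : Prop :=
  ∃ d : ℕ, ∀ τ : List Bool, K u (chi B) τ ≤ K u (chi A) τ + (d : ℕ∞)


/-- A `Σ^A_1` class in Cantor space. -/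
def Sigma1In (A : Set ℕ) (S : Set (ℕ → Bool)) : Prop :=
  ∃ W : Set (List Bool), CeIn A W ∧ S = Cyl W

/-- A `Π^A_1` class in Cantor space. -/
def Pi1In (A : Set ℕ) (S : Set (ℕ → Bool)) : Prop :=
  ∃ W : Set (List Bool), CeIn A W ∧ S = (Cyl W)ᶜ

/-- A `Σ^A_2` class: a union of a uniformly `Π^A_1` sequence of classes. -/
def Sigma2In (A : Set ℕ) (S : Set (ℕ → Bool)) : Prop :=
  ∃ W : ℕ → Set (List Bool), CeSeqIn A W ∧ S = ⋃ n, (Cyl (W n))ᶜ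

/-- A `Π^A_2` class: an intersection of a uniformly `Σ^A_1` sequence of classes. -/
def Pi2In (A : Set ℕ) (S : Set (ℕ → Bool)) : Prop :=
  ∃ W : ℕ → Set (List Bool), CeSeqIn A W ∧ S = ⋂ n, Cyl (W n)

/-- `f` dominates `g`: `f n ≥ g n` for all but finitely many `n`. -/
def Dominates (f g : ℕ → ℕ) : Prop := ∀ᶠ n in atTop, g n ≤ f n

/-- The oracle (characteristic function) associated to an element of Cantor space. -/
def oracleOf (X : ℕ → Bool) : ℕ → ℕ := fun n => cond (X n) 1 0

/-- `B` is uniformly almost everywhere dominating. -/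
def UAEDominating (B : Set ℕ) : Prop :=
  ∃ f : ℕ → ℕ, RecursiveIn (chi B) ↑f ∧
    ∀ᵐ X ∂mu, ∀ g : ℕ → ℕ, RecursiveIn (oracleOf X) ↑g → Dominates f g

/-- `B` is almost everywhere dominating. -/
def AEDominating (B : Set ℕ) : Prop :=
  ∀ᵐ X ∂mu, ∀ g : ℕ → ℕ, RecursiveIn (oracleOf X) ↑g →
    ∃ f : ℕ → ℕ, RecursiveIn (chi B) ↑f ∧ Dominates f g

/-- `B` is positive measure dominating. -/
def PMDominating (B : Set ℕ) : Prop :=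
  ∀ P : Set (ℕ → Bool), Pi2In ∅ P → 0 < mu P →
    ∃ Q : Set (ℕ → Bool), Pi1In B Q ∧ Q ⊆ P ∧ 0 < mu Q

open scoped ENNReal

/-- The fair coin on `Bool`. -/
noncomputable def coin : Measure Bool :=
  (2⁻¹ : ℝ≥0∞) • (Measure.dirac false + Measure.dirac true)

lemma coin_singleton (b : Bool) : coin {b} = 2⁻¹ := by
  cases b <;> simp [coin]

instance : IsProbabilityMeasure coin := ⟨by
  simp only [coin, Measure.smul_apply, Measure.add_apply, measure_univ, smul_eq_mul]
  rw [one_add_one_eq_two, ENNReal.inv_mul_cancel (by norm_num) (by norm_num)]⟩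

/-- The basic cylinder of sequences agreeing with `b` below `n`. -/
def basicCyl (n : ℕ) (b : ℕ → Bool) : Set (ℕ → Bool) := {X | ∀ i < n, X i = b i}

lemma measurableSet_basicCyl (n : ℕ) (b : ℕ → Bool) : MeasurableSet (basicCyl n b) := by
  have : basicCyl n b = ⋂ i ∈ Set.Iio n, (fun X : ℕ → Bool => X i) ⁻¹' {b i} := by
    ext X; simp [basicCyl]
  rw [this]
  exact MeasurableSet.biInter (Set.to_countable _) fun i _ =>
    measurable_pi_apply i (MeasurableSet.singleton _)

lemma isPiSystem_basicCyl : IsPiSystem {S | ∃ n b, S = basicCyl n b} := by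
  rintro _ ⟨n, b, rfl⟩ _ ⟨m, c, rfl⟩ ⟨Z, hZ⟩
  refine ⟨max n m, Z, ?_⟩
  ext X
  constructor
  · rintro ⟨h1, h2⟩ i hi
    rcases lt_max_iff.1 hi with h | h
    · rw [h1 i h, hZ.1 i h]
    · rw [h2 i h, hZ.2 i h]
  · intro h
    exact ⟨fun i hi => by rw [h i (lt_max_of_lt_left hi), hZ.1 i hi],
      fun i hi => by rw [h i (lt_max_of_lt_right hi), hZ.2 i hi]⟩

lemma generateFrom_basicCyl :
    (MeasurableSpace.pi : MeasurableSpace (ℕ → Bool)) =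
      MeasurableSpace.generateFrom {S | ∃ n b, S = basicCyl n b} := by
  apply le_antisymm
  · refine iSup_le fun i => ?_
    rw [← measurable_iff_comap_le]
    refine measurable_to_bool (f := fun X : ℕ → Bool => X i) ?_
    have : (fun X : ℕ → Bool => X i) ⁻¹' {true} =
        ⋃ σ ∈ {σ : Fin (i + 1) → Bool | σ (Fin.last i) = true},
          basicCyl (i + 1) (fun j => if h : j < i + 1 then σ ⟨j, h⟩ else false) := by
      ext X
      simp only [Set.mem_preimage, Set.mem_singleton_iff, Set.mem_iUnion, Set.mem_ofPred_eq,
        exists_prop]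
      constructor
      · intro h
        exact ⟨fun j => X j, by simpa using h, fun j hj => by simp [hj]⟩
      · rintro ⟨σ, h, hX⟩
        rw [hX i (Nat.lt_succ_self i)]
        exact (dif_pos (Nat.lt_succ_self i)).trans h
    rw [this]
    exact MeasurableSet.biUnion (Set.to_countable _) fun σ _ =>
      MeasurableSpace.measurableSet_generateFrom ⟨_, _, rfl⟩
  · refine MeasurableSpace.generateFrom_le ?_
    rintro _ ⟨n, b, rfl⟩
    exact measurableSet_basicCyl n b

lemma ext_of_basicCyl {ν ν' : Measure (ℕ → Bool)} [IsFiniteMeasure ν]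
    (h : ∀ n b, ν (basicCyl n b) = ν' (basicCyl n b)) : ν = ν' := by
  refine ext_of_generate_finite _ generateFrom_basicCyl isPiSystem_basicCyl ?_ ?_
  · rintro _ ⟨n, b, rfl⟩
    exact h n b
  · simpa [basicCyl] using h 0 fun _ => false

/-- The natural number with binary digits `b 0, …, b (n - 1)`, most significant first. -/
def binVal (b : ℕ → Bool) : ℕ → ℕ
  | 0 => 0
  | n + 1 => 2 * binVal b n + (b n).toNat

lemma binVal_lt (b : ℕ → Bool) (n : ℕ) : binVal b n < 2 ^ n := by
  induction n with
  | zero => simp [binVal]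
  | succ n ih =>
    have := Bool.toNat_le (b n)
    rw [binVal, pow_succ]; omega

lemma floor_mul_two_pow_succ_div (x : ℝ) (n : ℕ) :
    ⌊x * 2 ^ (n + 1)⌋₊ / 2 = ⌊x * 2 ^ n⌋₊ := by
  have := Nat.floor_div_natCast (x * 2 ^ (n + 1)) 2
  rw [← this]
  congr 1
  push_cast
  ring

lemma digits_iff_floor {x : ℝ} (hx : x ∈ Set.Ico (0 : ℝ) 1) (b : ℕ → Bool) (n : ℕ) :
    (∀ i < n, decide (⌊x * 2 ^ (i + 1)⌋₊ % 2 = 1) = b i) ↔ ⌊x * 2 ^ n⌋₊ = binVal b n := by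
  induction n with
  | zero =>
    simp only [not_lt_zero, false_imp_iff, implies_true, pow_zero, mul_one, binVal, true_iff]
    exact Nat.floor_eq_zero.2 hx.2
  | succ n ih =>
    have h1 := floor_mul_two_pow_succ_div x n
    rw [Nat.forall_lt_succ_right, ih, binVal]
    cases hb : b n <;> simp <;> omega

lemma measurable_digits :
    Measurable (fun (x : ℝ) (n : ℕ) => decide (⌊x * 2 ^ (n + 1)⌋₊ % 2 = 1)) := by
  refine measurable_pi_lambda _ fun n => ?_
  have h : Measurable fun x : ℝ => ⌊x * 2 ^ (n + 1)⌋₊ :=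
    Nat.measurable_floor.comp (measurable_id.mul_const _)
  exact (measurable_from_top (f := fun k : ℕ => decide (k % 2 = 1))).comp h

lemma mu_basicCyl (n : ℕ) (b : ℕ → Bool) : mu (basicCyl n b) = 2⁻¹ ^ n := by
  rw [mu, Measure.map_apply measurable_digits (measurableSet_basicCyl n b),
    Measure.restrict_apply (measurable_digits (measurableSet_basicCyl n b))]
  have hp : (0 : ℝ) < 2 ^ n := by positivity
  have : (fun (x : ℝ) (n : ℕ) => decide (⌊x * 2 ^ (n + 1)⌋₊ % 2 = 1)) ⁻¹' basicCyl n b ∩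
      Set.Ico (0 : ℝ) 1 = Set.Ico ((binVal b n : ℝ) / 2 ^ n) ((binVal b n + 1 : ℝ) / 2 ^ n) := by
    ext x
    have hlt : ((binVal b n : ℝ) + 1) ≤ 2 ^ n := by exact_mod_cast binVal_lt b n
    simp only [Set.mem_inter_iff, Set.mem_preimage, basicCyl, Set.mem_ofPred_eq]
    constructor
    · rintro ⟨h, hx⟩
      rw [digits_iff_floor hx, Nat.floor_eq_iff (by have := hx.1; positivity)] at h
      exact ⟨by rw [div_le_iff₀ hp]; exact h.1, by rw [lt_div_iff₀ hp]; exact h.2⟩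
    · rintro ⟨h1, h2⟩
      rw [div_le_iff₀ hp] at h1
      rw [lt_div_iff₀ hp] at h2
      have h0 : 0 ≤ x := by
        by_contra! hneg
        have : x * 2 ^ n < 0 := mul_neg_of_neg_of_pos hneg hp
        have : (0 : ℝ) ≤ binVal b n := Nat.cast_nonneg _
        linarith
      have hx1 : x < 1 := by
        by_contra! hge
        nlinarith
      refine ⟨?_, h0, hx1⟩
      rw [digits_iff_floor ⟨h0, hx1⟩, Nat.floor_eq_iff (by positivity)]
      exact ⟨h1, h2⟩
  rw [this, Real.volume_Ico, ← sub_div, add_sub_cancel_left, one_div, ENNReal.ofReal_inv_of_pos hp,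
    ENNReal.ofReal_pow (by norm_num), ENNReal.inv_pow]
  simp

instance : IsProbabilityMeasure mu := ⟨by
  simpa [basicCyl] using mu_basicCyl 0 fun _ => false⟩

lemma mu_eq_infinitePi : mu = Measure.infinitePi fun _ : ℕ => coin := by
  refine ext_of_basicCyl fun n b => ?_
  have : basicCyl n b = Set.pi (Finset.range n) fun i => {b i} := by
    ext X; simp [basicCyl]
  rw [mu_basicCyl, this, Measure.infinitePi_pi _ fun _ _ => MeasurableSet.singleton _]
  simp [coin_singleton]

/-- The `i`-th column of a sequence. -/
def column (i : ℕ) (X : ℕ → Bool) : ℕ → Bool := fun j => X (Nat.pair i j)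

lemma measurable_column (i : ℕ) : Measurable (column i) :=
  measurable_pi_lambda _ fun j => measurable_pi_apply (Nat.pair i j)

lemma mu_map_column (i : ℕ) : mu.map (column i) = mu := by
  rw [mu_eq_infinitePi]
  exact Measure.map_infinitePi_infinitePi_of_inj (P := fun _ : ℕ => coin) (f := Nat.pair i)
    fun a b h => (Nat.pair_eq_pair.1 h).2

lemma iIndepFun_column : ProbabilityTheory.iIndepFun column mu := by
  rw [ProbabilityTheory.iIndepFun_iff_map_fun_eq_infinitePi_map measurable_column]
  simp only [mu_map_column]
  have h1 : (fun (X : ℕ → Bool) (i : ℕ) => column i X) =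
      MeasurableEquiv.curry ℕ ℕ Bool ∘ fun X p => X (Nat.pairEquiv p) := by
    ext X i j; rfl
  rw [h1, ← Measure.map_map (by fun_prop) (by fun_prop)]
  conv_lhs => rw [mu_eq_infinitePi]
  rw [Measure.map_infinitePi_infinitePi_of_inj (P := fun _ : ℕ => coin) Nat.pairEquiv.injective,
    Measure.infinitePi_map_curry fun _ _ : ℕ => coin, ← mu_eq_infinitePi]

lemma mu_prepend (r : ℕ) {S : Set (ℕ → Bool)} (hS : MeasurableSet S) :
    mu {X | (∀ j < r, X j = false) ∧ (fun i => X (r + i)) ∈ S} = 2⁻¹ ^ r * mu S := by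
  have hm : Measurable fun (X : ℕ → Bool) (i : ℕ) => X (r + i) := by fun_prop
  have hC := measurableSet_basicCyl r fun _ => false
  have key : (mu.restrict (basicCyl r fun _ => false)).map (fun X i => X (r + i)) =
      (2⁻¹ ^ r : ℝ≥0∞) • mu := by
    refine ext_of_basicCyl fun n b => ?_
    rw [Measure.map_apply hm (measurableSet_basicCyl n b),
      Measure.restrict_apply (hm (measurableSet_basicCyl n b)), Measure.smul_apply, mu_basicCyl,
      smul_eq_mul, ← pow_add, ← mu_basicCyl (r + n) fun i => if i < r then false else b (i - r)]
    congr 1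
    ext X
    simp only [basicCyl, Set.mem_inter_iff, Set.mem_preimage, Set.mem_ofPred_eq]
    constructor
    · rintro ⟨h1, h2⟩ i hi
      split_ifs with h
      · exact h2 i h
      · have := h1 (i - r) (by omega)
        rwa [Nat.add_sub_cancel' (by omega)] at this
    · intro h
      refine ⟨fun i hi => ?_, fun i hi => ?_⟩
      · have := h (r + i) (by omega)
        rwa [if_neg (by omega), Nat.add_sub_cancel_left] at this
      · have := h i (by omega)
        rwa [if_pos hi] at this
  have := congrArg (fun ν => ν S) key
  simp only [Measure.smul_apply, smul_eq_mul] at this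
  rw [← this, Measure.map_apply hm hS, Measure.restrict_apply (hm hS)]
  congr 1
  ext X
  simp [basicCyl, and_comm]

namespace OracleCode

/-- Evaluation of an oracle code relative to a partial oracle. -/
def evalP (O : ℕ →. ℕ) : OracleCode → ℕ →. ℕ
  | zero => pure 0
  | succ => Nat.succ
  | left => ↑fun n : ℕ => n.unpair.1
  | right => ↑fun n : ℕ => n.unpair.2
  | oracle => O
  | pair cf cg => fun n => Nat.pair <$> evalP O cf n <*> evalP O cg n
  | comp cf cg => fun n => evalP O cg n >>= evalP O cf
  | prec cf cg =>
    Nat.unpaired fun a n =>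
      n.rec (evalP O cf a) fun y IH => do
        let i ← IH
        evalP O cg (Nat.pair a (Nat.pair y i))
  | rfind' cf =>
    Nat.unpaired fun a m =>
      (Nat.rfind fun n => (fun m => m = 0) <$> evalP O cf (Nat.pair a (n + m))).map (· + m)

lemma mem_evalP_pair {O : ℕ →. ℕ} {cf cg : OracleCode} {n v : ℕ} :
    v ∈ evalP O (pair cf cg) n ↔ ∃ a ∈ evalP O cf n, ∃ b ∈ evalP O cg n, Nat.pair a b = v := by
  change v ∈ (Nat.pair <$> evalP O cf n <*> evalP O cg n : Part ℕ) ↔ _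
  generalize evalP O cf n = p
  generalize evalP O cg n = q
  simp [Seq.seq]

lemma mem_evalP_comp {O : ℕ →. ℕ} {cf cg : OracleCode} {n v : ℕ} :
    v ∈ evalP O (comp cf cg) n ↔ ∃ a ∈ evalP O cg n, v ∈ evalP O cf a :=
  Part.mem_bind_iff

lemma evalP_prec_zero {O : ℕ →. ℕ} {cf cg : OracleCode} {a : ℕ} :
    evalP O (prec cf cg) (Nat.pair a 0) = evalP O cf a := by
  simp [evalP, Nat.unpaired]

lemma mem_evalP_prec_succ {O : ℕ →. ℕ} {cf cg : OracleCode} {a y v : ℕ} :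
    v ∈ evalP O (prec cf cg) (Nat.pair a (y + 1)) ↔
      ∃ i ∈ evalP O (prec cf cg) (Nat.pair a y),
        v ∈ evalP O cg (Nat.pair a (Nat.pair y i)) := by
  have h : ∀ k, evalP O (prec cf cg) (Nat.pair a k) = Nat.rec (evalP O cf a) (fun y IH => do
        let i ← IH
        evalP O cg (Nat.pair a (Nat.pair y i))) k := by
    intro k; simp [evalP, Nat.unpaired]
  rw [h, h]
  exact Part.mem_bind_iff

lemma mem_rfind_map {p : ℕ → Part ℕ} {m v : ℕ} :
    v ∈ (Nat.rfind fun n => (fun m => decide (m = 0)) <$> p n).map (· + m) ↔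
      ∃ k, 0 ∈ p k ∧ (∀ j < k, ∃ a ∈ p j, a ≠ 0) ∧ k + m = v := by
  have h : ∀ k, k ∈ (Nat.rfind fun n => (fun m => decide (m = 0)) <$> p n) ↔
      0 ∈ p k ∧ (∀ j < k, ∃ a ∈ p j, a ≠ 0) := by
    intro k
    refine Nat.mem_rfind.trans (and_congr ?_ (forall_congr' fun j => forall_congr' fun _ => ?_))
    · exact (Part.mem_map_iff _).trans (by simp)
    · exact (Part.mem_map_iff _).trans (by simp)
  simp only [Part.mem_map_iff, h, and_assoc]

lemma mem_evalP_rfind' {O : ℕ →. ℕ} {cf : OracleCode} {a m v : ℕ} :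
    v ∈ evalP O (rfind' cf) (Nat.pair a m) ↔
      ∃ k, 0 ∈ evalP O cf (Nat.pair a (k + m)) ∧
        (∀ j < k, ∃ b ∈ evalP O cf (Nat.pair a (j + m)), b ≠ 0) ∧ k + m = v := by
  have := mem_rfind_map (p := fun n => evalP O cf (Nat.pair a (n + m))) (m := m) (v := v)
  rw [← this]
  simp [evalP, Nat.unpaired]

lemma evalP_coe (O : ℕ → ℕ) (c : OracleCode) : evalP (↑O) c = eval O c := by
  induction c with
  | zero | succ | left | right | oracle => rfl
  | pair cf cg hf hg | comp cf cg hf hg | prec cf cg hf hg =>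
    simp only [evalP, eval, hf, hg]; rfl
  | rfind' cf hf => simp only [evalP, eval, hf]; rfl

lemma eventually_mem_evalP {ι : Type*} {F : Filter ι} {O : ℕ →. ℕ} {O' : ι → ℕ →. ℕ}
    (hO : ∀ n v, v ∈ O n → ∀ᶠ m in F, v ∈ O' m n) (c : OracleCode) :
    ∀ n v, v ∈ evalP O c n → ∀ᶠ m in F, v ∈ evalP (O' m) c n := by
  induction c with
  | zero | succ | left | right => exact fun n v h => Eventually.of_forall fun _ => h
  | oracle => exact hO
  | pair cf cg hf hg =>
    intro n v h
    obtain ⟨a, ha, b, hb, rfl⟩ := mem_evalP_pair.1 h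
    filter_upwards [hf n a ha, hg n b hb] with m h1 h2
    exact mem_evalP_pair.2 ⟨a, h1, b, h2, rfl⟩
  | comp cf cg hf hg =>
    intro n v h
    obtain ⟨a, ha, hb⟩ := mem_evalP_comp.1 h
    filter_upwards [hg n a ha, hf a v hb] with m h1 h2
    exact mem_evalP_comp.2 ⟨a, h1, h2⟩
  | prec cf cg hf hg =>
    intro n
    rw [← Nat.pair_unpair n]
    generalize n.unpair.1 = a
    induction n.unpair.2 with
    | zero => simp only [evalP_prec_zero]; exact fun v h => hf a v h
    | succ y IH =>
      intro v h
      obtain ⟨i, hi, hv⟩ := mem_evalP_prec_succ.1 h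
      filter_upwards [IH i hi, hg _ v hv] with m h1 h2
      exact mem_evalP_prec_succ.2 ⟨i, h1, h2⟩
  | rfind' cf hf =>
    intro n v
    rw [← Nat.pair_unpair n]
    intro h
    obtain ⟨k, hb, hlt, rfl⟩ := mem_evalP_rfind'.1 h
    have h2 : ∀ᶠ m in F, ∀ j ∈ Set.Iio k, ∃ a ∈ evalP (O' m) cf
        (Nat.pair n.unpair.1 (j + n.unpair.2)), a ≠ 0 := by
      rw [(Set.finite_Iio k).eventually_all]
      intro j hj
      obtain ⟨a, ha, ha0⟩ := hlt j hj
      filter_upwards [hf _ a ha] with m hm using ⟨a, hm, ha0⟩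
    filter_upwards [hf _ 0 hb, h2] with m h3 h4
    exact mem_evalP_rfind'.2 ⟨k, h3, h4, rfl⟩

end OracleCode

namespace CodeEval
open Nat.Partrec Nat.Partrec.Code

lemma mem_pair {cf cg : Code} {n v : ℕ} :
    v ∈ eval (pair cf cg) n ↔ ∃ a ∈ eval cf n, ∃ b ∈ eval cg n, Nat.pair a b = v := by
  change v ∈ (Nat.pair <$> eval cf n <*> eval cg n : Part ℕ) ↔ _
  generalize eval cf n = p
  generalize eval cg n = q
  simp [Seq.seq]

lemma mem_comp {cf cg : Code} {n v : ℕ} :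
    v ∈ eval (comp cf cg) n ↔ ∃ a ∈ eval cg n, v ∈ eval cf a :=
  Part.mem_bind_iff

lemma prec_zero {cf cg : Code} {a : ℕ} : eval (prec cf cg) (Nat.pair a 0) = eval cf a := by
  simp [eval, Nat.unpaired]

lemma mem_prec_succ {cf cg : Code} {a y v : ℕ} :
    v ∈ eval (prec cf cg) (Nat.pair a (y + 1)) ↔
      ∃ i ∈ eval (prec cf cg) (Nat.pair a y), v ∈ eval cg (Nat.pair a (Nat.pair y i)) := by
  have h : ∀ k, eval (prec cf cg) (Nat.pair a k) = Nat.rec (eval cf a) (fun y IH => do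
        let i ← IH
        eval cg (Nat.pair a (Nat.pair y i))) k := by
    intro k; simp [eval, Nat.unpaired]
  rw [h, h]
  exact Part.mem_bind_iff

lemma mem_rfind' {cf : Code} {a m v : ℕ} :
    v ∈ eval (rfind' cf) (Nat.pair a m) ↔
      ∃ k, 0 ∈ eval cf (Nat.pair a (k + m)) ∧
        (∀ j < k, ∃ b ∈ eval cf (Nat.pair a (j + m)), b ≠ 0) ∧ k + m = v := by
  have := OracleCode.mem_rfind_map (p := fun n => eval cf (Nat.pair a (n + m))) (m := m) (v := v)
  rw [← this]
  simp [eval, Nat.unpaired]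

lemma mem_left {n v : ℕ} : v ∈ eval left n ↔ n.unpair.1 = v := by
  simp [eval, eq_comm]

lemma mem_right {n v : ℕ} : v ∈ eval right n ↔ n.unpair.2 = v := by
  simp [eval, eq_comm]

end CodeEval

/-- A finite binary string as a partial oracle. -/
def strOracle (l : List Bool) : ℕ →. ℕ := fun n => Part.ofOption (l[n]?.map Bool.toNat)

lemma partrec_strOracle : Nat.Partrec fun p : ℕ =>
    Part.ofOption (((Encodable.decode (α := List Bool) p.unpair.1).getD [])[p.unpair.2]?.map
      Bool.toNat) := by
  refine Partrec.nat_iff.1 (Computable.ofOption ?_)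
  refine Primrec.to_comp ?_
  refine Primrec.option_map ?_ ((Primrec.dom_finite _).comp₂ Primrec₂.right)
  refine Primrec.list_getElem?.comp ?_ (Primrec.snd.comp Primrec.unpair)
  exact Primrec.option_getD.comp (Primrec.decode.comp (Primrec.fst.comp Primrec.unpair))
    (Primrec.const [])

/-- A code for reading a finite string as an oracle. -/
noncomputable def readCode : Nat.Partrec.Code :=
  (Nat.Partrec.Code.exists_code.1 partrec_strOracle).choose

lemma eval_readCode (l : List Bool) (n : ℕ) :
    Nat.Partrec.Code.eval readCode (Nat.pair (Encodable.encode l) n) = strOracle l n := by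
  rw [readCode, (Nat.Partrec.Code.exists_code.1 partrec_strOracle).choose_spec]
  simp [strOracle]

open Nat.Partrec Nat.Partrec.Code in
/-- The argument `(σ, (a, b))` rearranged as `((σ, a), b)`. -/
def assocCode : Code :=
  .pair (.pair .left (.comp .left .right)) (.comp .right .right)

open Nat.Partrec Nat.Partrec.Code in
/-- The argument `((σ, a), b)` rearranged as `(σ, (a, b))`. -/
def unassocCode : Code :=
  .pair (.comp .left .left) (.pair (.comp .right .left) .right)

open Nat.Partrec Nat.Partrec.Code in
/-- Translation of oracle codes into codes receiving a finite oracle as extra argument. -/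
noncomputable def tr : OracleCode → Code
  | .zero => .zero
  | .succ => .comp .succ .right
  | .left => .comp .left .right
  | .right => .comp .right .right
  | .oracle => readCode
  | .pair cf cg => .pair (tr cf) (tr cg)
  | .comp cf cg => .comp (tr cf) (.pair .left (tr cg))
  | .prec cf cg => .comp (.prec (tr cf) (.comp (tr cg) unassocCode)) assocCode
  | .rfind' cf => .comp (.rfind' (.comp (tr cf) unassocCode)) assocCode

lemma mem_assoc {s a b v : ℕ} :
    v ∈ Nat.Partrec.Code.eval assocCode (Nat.pair s (Nat.pair a b)) ↔
      Nat.pair (Nat.pair s a) b = v := by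
  simp [assocCode, CodeEval.mem_pair, CodeEval.mem_comp, CodeEval.mem_left, CodeEval.mem_right]

lemma mem_unassoc {s a b v : ℕ} :
    v ∈ Nat.Partrec.Code.eval unassocCode (Nat.pair (Nat.pair s a) b) ↔
      Nat.pair s (Nat.pair a b) = v := by
  simp [unassocCode, CodeEval.mem_pair, CodeEval.mem_comp, CodeEval.mem_left, CodeEval.mem_right]

lemma mem_eval_tr (l : List Bool) (c : OracleCode) : ∀ n v,
    v ∈ Nat.Partrec.Code.eval (tr c) (Nat.pair (Encodable.encode l) n) ↔
      v ∈ c.evalP (strOracle l) n := by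
  induction c with
  | zero => exact fun n v => Iff.rfl
  | succ =>
    intro n v
    simp only [tr, CodeEval.mem_comp, CodeEval.mem_right, Nat.unpair_pair, exists_eq_left']
    rfl
  | left =>
    intro n v
    simp only [tr, CodeEval.mem_comp, CodeEval.mem_right, Nat.unpair_pair, exists_eq_left']
    rfl
  | right =>
    intro n v
    simp only [tr, CodeEval.mem_comp, CodeEval.mem_right, Nat.unpair_pair, exists_eq_left']
    simp [OracleCode.evalP, eq_comm]
  | oracle => intro n v; simp only [tr, eval_readCode]; rfl
  | pair cf cg hf hg =>
    intro n v
    simp only [tr, CodeEval.mem_pair, OracleCode.mem_evalP_pair, hf, hg]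
  | comp cf cg hf hg =>
    intro n v
    simp only [tr, CodeEval.mem_comp, CodeEval.mem_pair, CodeEval.mem_left, Nat.unpair_pair,
      exists_eq_left', OracleCode.mem_evalP_comp, hg]
    constructor
    · rintro ⟨_, ⟨b, hb, rfl⟩, h⟩
      exact ⟨b, hb, (hf _ _).1 h⟩
    · rintro ⟨b, hb, h⟩
      exact ⟨_, ⟨b, hb, rfl⟩, (hf _ _).2 h⟩
  | prec cf cg hf hg =>
    intro n
    rw [← Nat.pair_unpair n]
    generalize n.unpair.1 = a
    simp only [tr, CodeEval.mem_comp, mem_assoc, exists_eq_left']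
    induction n.unpair.2 with
    | zero => simpa only [CodeEval.prec_zero, OracleCode.evalP_prec_zero] using hf a
    | succ y IH =>
      intro v
      simp only [CodeEval.mem_prec_succ, OracleCode.mem_evalP_prec_succ, IH, CodeEval.mem_comp,
        mem_unassoc, exists_eq_left', hg]
  | rfind' cf hf =>
    intro n v
    rw [← Nat.pair_unpair n]
    simp only [tr, CodeEval.mem_comp, mem_assoc, exists_eq_left', CodeEval.mem_rfind',
      OracleCode.mem_evalP_rfind', mem_unassoc, hf]

section
open Nat.Partrec Nat.Partrec.Code

/-- The translated code with number `l.length`, given the translations of smaller numbers. -/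
noncomputable def trStep (l : List Code) : Code :=
  let q := (l.length - 5) / 4
  let r := (l.length - 5) % 4
  let x := l.getD q.unpair.1 .zero
  let y := l.getD q.unpair.2 .zero
  if l.length = 0 then .zero
  else if l.length = 1 then .comp .succ .right
  else if l.length = 2 then .comp .left .right
  else if l.length = 3 then .comp .right .right
  else if l.length = 4 then readCode
  else if r = 0 then .pair x y
  else if r = 1 then .comp x (.pair .left y)
  else if r = 2 then .comp (.prec x (.comp y unassocCode)) assocCode
  else .comp (.rfind' (.comp (l.getD q .zero) unassocCode)) assocCode

/-- The list of translated codes with numbers below `n`. -/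
noncomputable def trList (n : ℕ) : List Code :=
  Nat.rec [] (fun _ l => l ++ [trStep l]) n

/-- The translation of the oracle code with number `n`. -/
noncomputable def trN (n : ℕ) : Code := trStep (trList n)

lemma primrec_trStep : Primrec trStep := by
  have hn : Primrec fun l : List Code => l.length := Primrec.list_length
  have h5 : Primrec fun l : List Code => l.length - 5 := Primrec.nat_sub.comp hn (.const 5)
  have hq : Primrec fun l : List Code => (l.length - 5) / 4 := Primrec.nat_div.comp h5 (.const 4)
  have hr : Primrec fun l : List Code => (l.length - 5) % 4 := Primrec.nat_mod.comp h5 (.const 4)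
  have hx : Primrec fun l : List Code => l.getD ((l.length - 5) / 4).unpair.1 Code.zero :=
    (Primrec.list_getD _).comp .id (Primrec.fst.comp (Primrec.unpair.comp hq))
  have hy : Primrec fun l : List Code => l.getD ((l.length - 5) / 4).unpair.2 Code.zero :=
    (Primrec.list_getD _).comp .id (Primrec.snd.comp (Primrec.unpair.comp hq))
  have hz : Primrec fun l : List Code => l.getD ((l.length - 5) / 4) Code.zero :=
    (Primrec.list_getD _).comp .id hq
  have eqc : ∀ {f : List Code → ℕ}, Primrec f → ∀ k, PrimrecPred fun l => f l = k :=
    fun hf k => Primrec.eq.comp hf (.const k)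
  unfold trStep
  refine .ite (eqc hn 0) (.const _) (.ite (eqc hn 1) (.const _) (.ite (eqc hn 2) (.const _)
    (.ite (eqc hn 3) (.const _) (.ite (eqc hn 4) (.const _) (.ite (eqc hr 0) ?_
    (.ite (eqc hr 1) ?_ (.ite (eqc hr 2) ?_ ?_)))))))
  · exact primrec₂_pair.comp hx hy
  · exact primrec₂_comp.comp hx (primrec₂_pair.comp (.const _) hy)
  · exact primrec₂_comp.comp (primrec₂_prec.comp hx (primrec₂_comp.comp hy (.const _))) (.const _)
  · exact primrec₂_comp.comp (primrec_rfind'.comp (primrec₂_comp.comp hz (.const _))) (.const _)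

lemma primrec_trN : Primrec trN := by
  refine primrec_trStep.comp (Primrec.nat_rec' (f := fun n : ℕ => n) (g := fun _ => [])
    (h := fun _ p => p.2 ++ [trStep p.2]) .id (.const []) ?_)
  have h : Primrec fun p : ℕ × ℕ × List Code => p.2.2 := Primrec.snd.comp Primrec.snd
  exact (Primrec.list_concat.comp h (primrec_trStep.comp h))

lemma trList_succ (n : ℕ) : trList (n + 1) = trList n ++ [trN n] := rfl

lemma trList_eq (n : ℕ) : trList n = (List.range n).map trN := by
  induction n with
  | zero => rfl
  | succ n ih => rw [trList_succ, ih, List.range_succ, List.map_append]; rfl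

lemma trList_getD {n q : ℕ} (h : q < n) : (trList n).getD q .zero = trN q := by
  rw [trList_eq]; simp [h]

lemma length_trList (n : ℕ) : (trList n).length = n := by rw [trList_eq]; simp

lemma trN_add (m r : ℕ) (hr : r < 4) : trN (4 * m + 5 + r) =
    if r = 0 then .pair (trN m.unpair.1) (trN m.unpair.2)
    else if r = 1 then .comp (trN m.unpair.1) (.pair .left (trN m.unpair.2))
    else if r = 2 then
      .comp (.prec (trN m.unpair.1) (.comp (trN m.unpair.2) unassocCode)) assocCode
    else .comp (.rfind' (.comp (trN m) unassocCode)) assocCode := by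
  have h1 : (4 * m + 5 + r - 5) / 4 = m := by omega
  have h2 : (4 * m + 5 + r - 5) % 4 = r := by omega
  have h3 := trList_getD (n := 4 * m + 5 + r) (q := m.unpair.1)
    (by have := Nat.unpair_left_le m; omega)
  have h4 := trList_getD (n := 4 * m + 5 + r) (q := m.unpair.2)
    (by have := Nat.unpair_right_le m; omega)
  have h5 := trList_getD (n := 4 * m + 5 + r) (q := m) (by omega)
  conv_lhs => rw [trN, trStep]
  simp only [length_trList, h1, h2, h3, h4, h5]
  iterate 5 rw [if_neg (by omega)]

lemma trN_encodeCode (c : OracleCode) : trN c.encodeCode = tr c := by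
  induction c with
  | zero | succ | left | right | oracle =>
    simp [trN, trStep, length_trList, OracleCode.encodeCode, tr]
  | pair cf cg hf hg =>
    have h := trN_add (Nat.pair cf.encodeCode cg.encodeCode) 0 (by omega)
    simp [hf, hg] at h
    exact h
  | comp cf cg hf hg =>
    have h := trN_add (Nat.pair cf.encodeCode cg.encodeCode) 1 (by omega)
    simp [hf, hg] at h
    exact h
  | prec cf cg hf hg =>
    have h := trN_add (Nat.pair cf.encodeCode cg.encodeCode) 2 (by omega)
    simp [hf, hg] at h
    exact h
  | rfind' cf hf =>
    have h := trN_add cf.encodeCode 3 (by omega)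
    simp [hf] at h
    exact h

end

/-- The first `n` bits of `X`. -/
def res (X : ℕ → Bool) (n : ℕ) : List Bool := (List.range n).map X

@[simp] lemma length_res (X : ℕ → Bool) (n : ℕ) : (res X n).length = n := by simp [res]

lemma res_prefix (X : ℕ → Bool) {m n : ℕ} (h : m ≤ n) : res X m <+: res X n := by
  obtain ⟨k, rfl⟩ := Nat.exists_eq_add_of_le h
  rw [res, res, List.range_add, List.map_append]
  exact List.prefix_append _ _

lemma res_succ (X : ℕ → Bool) (n : ℕ) : res X (n + 1) = res X n ++ [X n] := by
  simp [res, List.range_succ]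

lemma take_res (X : ℕ → Bool) {m n : ℕ} (h : m ≤ n) : (res X n).take m = res X m := by
  have := (List.prefix_iff_eq_take.1 (res_prefix X h))
  rw [this]; simp

lemma eq_res_of_prefix {X : ℕ → Bool} {l : List Bool} {n : ℕ} (h : l <+: res X n) :
    l = res X l.length := by
  have hl := h.length_le
  rw [length_res] at hl
  rw [List.prefix_iff_eq_take.1 h, take_res X hl]; simp

lemma getElem?_res (X : ℕ → Bool) {n m : ℕ} : (res X n)[m]? = if m < n then some (X m) else none := by
  simp only [res, List.getElem?_map]
  split_ifs with h <;> simp [h]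

lemma res_eq_res_iff {X Y : ℕ → Bool} {n : ℕ} : res X n = res Y n ↔ ∀ i < n, X i = Y i := by
  simp [res]

/-- Step-bounded evaluation of the oracle code numbered `e` with finite oracle `l`. -/
noncomputable def uEval (s : ℕ) (l : List Bool) (e n : ℕ) : Option ℕ :=
  Nat.Partrec.Code.evaln s (trN e) (Nat.pair (Encodable.encode l) n)

lemma primrec_uEval {α : Type*} [Primcodable α] {s e n : α → ℕ} {l : α → List Bool}
    (hs : Primrec s) (hl : Primrec l) (he : Primrec e) (hn : Primrec n) :
    Primrec fun a => uEval (s a) (l a) (e a) (n a) :=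
  Nat.Partrec.Code.primrec_evaln.comp ((hs.pair (primrec_trN.comp he)).pair
    (Primrec₂.natPair.comp (Primrec.encode.comp hl) hn))

lemma uEval_mono {s s' : ℕ} {l : List Bool} {e n v : ℕ} (h : s ≤ s') (hv : uEval s l e n = some v) :
    uEval s' l e n = some v :=
  Nat.Partrec.Code.evaln_mono h hv

lemma exists_uEval_iff {l : List Bool} {c : OracleCode} {n v : ℕ} :
    (∃ s, uEval s l c.encodeCode n = some v) ↔ v ∈ c.evalP (strOracle l) n := by
  rw [← mem_eval_tr, Nat.Partrec.Code.evaln_complete]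
  simp [uEval, trN_encodeCode]

lemma mem_strOracle_res {X : ℕ → Bool} {m n v : ℕ} :
    v ∈ strOracle (res X m) n ↔ n < m ∧ oracleOf X n = v := by
  simp only [strOracle, getElem?_res, oracleOf]
  split_ifs with h <;> cases X n <;> simp [h, eq_comm]

lemma mem_eval_oracleOf {X : ℕ → Bool} {c : OracleCode} {n v : ℕ} :
    v ∈ c.eval (oracleOf X) n ↔ ∃ m s, uEval s (res X m) c.encodeCode n = some v := by
  simp only [exists_uEval_iff]
  rw [← OracleCode.evalP_coe]
  constructor
  · intro h
    have := OracleCode.eventually_mem_evalP (F := atTop) (O' := fun m => strOracle (res X m)) ?_ c n v h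
    · exact this.exists
    · intro n v hv
      filter_upwards [eventually_gt_atTop n] with m hm
      exact mem_strOracle_res.2 ⟨hm, (Part.mem_some_iff.1 hv).symm⟩
  · rintro ⟨m, h⟩
    have := OracleCode.eventually_mem_evalP (F := (pure () : Filter Unit))
      (O' := fun _ => (↑(oracleOf X) : ℕ →. ℕ)) ?_ c n v h
    · exact this
    · intro n v hv
      exact Filter.Eventually.of_forall fun _ => Part.mem_some_iff.2 (mem_strOracle_res.1 hv).2.symm

namespace Pr
variable {α β γ σ : Type*} [Primcodable α] [Primcodable β] [Primcodable γ] [Primcodable σ]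

attribute [fun_prop] Primrec PrimrecPred
attribute [fun_prop] Primrec.id Primrec.const Primrec.comp Primrec.fst Primrec.snd Primrec.pair
  Primrec.succ Primrec.unpair Primrec.encode Primrec.decode primrec_uEval PrimrecPred.and
  PrimrecPred.or PrimrecPred.not PrimrecPred.comp

@[fun_prop] lemma add {f g : α → ℕ} (hf : Primrec f) (hg : Primrec g) :
    Primrec fun a => f a + g a := Primrec.nat_add.comp hf hg

@[fun_prop] lemma sub {f g : α → ℕ} (hf : Primrec f) (hg : Primrec g) :
    Primrec fun a => f a - g a := Primrec.nat_sub.comp hf hg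

@[fun_prop] lemma mul {f g : α → ℕ} (hf : Primrec f) (hg : Primrec g) :
    Primrec fun a => f a * g a := Primrec.nat_mul.comp hf hg

@[fun_prop] lemma max {f g : α → ℕ} (hf : Primrec f) (hg : Primrec g) :
    Primrec fun a => Max.max (f a) (g a) := Primrec.nat_max.comp hf hg

@[fun_prop] lemma pow {f g : α → ℕ} (hf : Primrec f) (hg : Primrec g) :
    Primrec fun a => f a ^ g a :=
  (Primrec₂.unpaired'.1 Nat.Primrec.pow : Primrec₂ fun a b : ℕ => a ^ b).comp hf hg

@[fun_prop] lemma natPair {f g : α → ℕ} (hf : Primrec f) (hg : Primrec g) :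
    Primrec fun a => Nat.pair (f a) (g a) := Primrec₂.natPair.comp hf hg

@[fun_prop] lemma take {f : α → ℕ} {g : α → List β} (hf : Primrec f) (hg : Primrec g) :
    Primrec fun a => (g a).take (f a) := Primrec.list_take.comp hf hg

@[fun_prop] lemma drop {f : α → ℕ} {g : α → List β} (hf : Primrec f) (hg : Primrec g) :
    Primrec fun a => (g a).drop (f a) := Primrec.list_drop.comp hf hg

@[fun_prop] lemma length {g : α → List β} (hg : Primrec g) : Primrec fun a => (g a).length :=
  Primrec.list_length.comp hg

@[fun_prop] lemma dropLast {g : α → List β} (hg : Primrec g) :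
    Primrec fun a => (g a).dropLast := by
  simp only [List.dropLast_eq_take]; fun_prop

@[fun_prop] lemma cons {f : α → β} {g : α → List β} (hf : Primrec f) (hg : Primrec g) :
    Primrec fun a => f a :: g a := Primrec.list_cons.comp hf hg

@[fun_prop] lemma append {f g : α → List β} (hf : Primrec f) (hg : Primrec g) :
    Primrec fun a => f a ++ g a := Primrec.list_append.comp hf hg

@[fun_prop] lemma getElem? {f : α → ℕ} {g : α → List β} (hf : Primrec f) (hg : Primrec g) :
    Primrec fun a => (g a)[f a]? := Primrec.list_getElem?.comp hg hf

@[fun_prop] lemma getD {f : α → ℕ} {g : α → List β} {d : β} (hf : Primrec f) (hg : Primrec g) :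
    Primrec fun a => (g a).getD (f a) d := (Primrec.list_getD d).comp hg hf

@[fun_prop] lemma optGetD {f : α → Option β} {g : α → β} (hf : Primrec f) (hg : Primrec g) :
    Primrec fun a => (f a).getD (g a) := Primrec.option_getD.comp hf hg

@[fun_prop] lemma some {f : α → β} (hf : Primrec f) :
    Primrec fun a => Option.some (f a) := Primrec.option_some.comp hf

@[fun_prop] lemma range {f : α → ℕ} (hf : Primrec f) :
    Primrec fun a => List.range (f a) := Primrec.list_range.comp hf

@[fun_prop] lemma eq {f g : α → β} (hf : Primrec f) (hg : Primrec g) :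
    PrimrecPred fun a => f a = g a := by
  classical exact Primrec.eq.comp hf hg

@[fun_prop] lemma le {f g : α → ℕ} (hf : Primrec f) (hg : Primrec g) :
    PrimrecPred fun a => f a ≤ g a := Primrec.nat_le.comp hf hg

@[fun_prop] lemma lt {f g : α → ℕ} (hf : Primrec f) (hg : Primrec g) :
    PrimrecPred fun a => f a < g a := Primrec.nat_lt.comp hf hg

@[fun_prop] lemma imp {p q : α → Prop} (hp : PrimrecPred p) (hq : PrimrecPred q) :
    PrimrecPred fun a => p a → q a := (hp.not.or hq).of_eq fun _ => by tauto

@[fun_prop] lemma iff {p q : α → Prop} (hp : PrimrecPred p) (hq : PrimrecPred q) :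
    PrimrecPred fun a => p a ↔ q a := ((imp hp hq).and (imp hq hp)).of_eq fun _ => by tauto

@[fun_prop] lemma constP (p : Prop) : PrimrecPred fun _ : α => p := by
  by_cases h : p
  · exact (eq (.const 0) (.const 0) : PrimrecPred fun _ : α => 0 = 0).of_eq fun _ => by simp [h]
  · exact (eq (.const 0) (.const 1) : PrimrecPred fun _ : α => 0 = 1).of_eq fun _ => by simp [h]

lemma ex_mem {f : α → List β} {p : α → β → Prop} (hf : Primrec f)
    (hp : PrimrecPred fun x : α × β => p x.1 x.2) : PrimrecPred fun a => ∃ b ∈ f a, p a b :=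
  (PrimrecRel.exists_mem_list (R := fun b a => p a b)
    (show PrimrecPred _ from hp.comp (.pair .snd .fst))).comp hf .id

lemma all_mem {f : α → List β} {p : α → β → Prop} (hf : Primrec f)
    (hp : PrimrecPred fun x : α × β => p x.1 x.2) : PrimrecPred fun a => ∀ b ∈ f a, p a b :=
  (PrimrecRel.forall_mem_list (R := fun b a => p a b)
    (show PrimrecPred _ from hp.comp (.pair .snd .fst))).comp hf .id

lemma ex_lt {f : α → ℕ} {p : α → ℕ → Prop} (hf : Primrec f)
    (hp : PrimrecPred fun x : α × ℕ => p x.1 x.2) : PrimrecPred fun a => ∃ b < f a, p a b :=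
  (ex_mem (range hf) hp).of_eq fun _ => by simp

lemma all_lt {f : α → ℕ} {p : α → ℕ → Prop} (hf : Primrec f)
    (hp : PrimrecPred fun x : α × ℕ => p x.1 x.2) : PrimrecPred fun a => ∀ b < f a, p a b :=
  (all_mem (range hf) hp).of_eq fun _ => by simp

@[fun_prop] lemma mem {f : α → β} {g : α → List β} (hf : Primrec f) (hg : Primrec g) :
    PrimrecPred fun a => f a ∈ g a :=
  (ex_mem (p := fun a b => b = f a) hg (by fun_prop)).of_eq fun _ => by simp

@[fun_prop] lemma isPrefix {f g : α → List β} (hf : Primrec f) (hg : Primrec g) :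
    PrimrecPred fun a => f a <+: g a :=
  (eq hf (take (length hf) hg)).of_eq fun _ => List.prefix_iff_eq_take.symm

lemma ex_opt {f : α → Option β} {p : α → β → Prop} (hf : Primrec f)
    (hp : PrimrecPred fun x : α × β => p x.1 x.2) :
    PrimrecPred fun a => ∃ b, f a = Option.some b ∧ p a b := by
  have h2 : Primrec₂ fun (_ : α) (b : β) => [b] :=
    Primrec.list_cons.comp₂ Primrec₂.right (Primrec₂.const [])
  have h : Primrec fun a => ((f a).casesOn [] fun b => [b] : List β) :=
    Primrec.option_casesOn hf (.const []) h2
  exact (ex_mem h hp).of_eq fun a => by cases f a <;> simp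

open Classical in
lemma ite {p : α → Prop} {f g : α → β} (hp : PrimrecPred p) (hf : Primrec f) (hg : Primrec g) :
    Primrec fun a => if p a then f a else g a := Primrec.ite hp hf hg

open Classical in
lemma decide {p : α → Prop} (hp : PrimrecPred p) : Primrec fun a => Decidable.decide (p a) :=
  (ite hp (.const true) (.const false)).of_eq fun a => by by_cases h : p a <;> simp [h]

lemma map {f : α → List β} {g : α → β → γ} (hf : Primrec f)
    (hg : Primrec fun x : α × β => g x.1 x.2) : Primrec fun a => (f a).map (g a) :=
  Primrec.list_map hf hg

lemma nat_rec {f : α → ℕ} {g : α → β} {h : α → ℕ → β → β} (hf : Primrec f) (hg : Primrec g)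
    (hh : Primrec fun x : α × ℕ × β => h x.1 x.2.1 x.2.2) :
    Primrec fun a => (Nat.rec (g a) (h a) (f a) : β) :=
  Primrec.nat_rec' (h := fun a p => h a p.1 p.2) hf hg hh

end Pr

/-- `p` is c.e. relative to the oracle `X`, with a use-monotone normal form. -/
def CE {α : Type*} [Primcodable α] (X : ℕ → Bool) (p : α → Prop) : Prop :=
  ∃ q : α × List Bool → Prop, PrimrecPred q ∧
    (∀ a l l', l <+: l' → q (a, l) → q (a, l')) ∧ ∀ a, p a ↔ ∃ m, q (a, res X m)

namespace CE
variable {α β γ : Type*} [Primcodable α] [Primcodable β] [Primcodable γ] {X : ℕ → Bool}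

lemma of_eq {p p' : α → Prop} (h : CE X p) (hp : ∀ a, p a ↔ p' a) : CE X p' := by
  rwa [show p' = p from funext fun a => propext (hp a).symm]

lemma mk' {p : α → Prop} (q : α × List Bool → Prop) (hq : PrimrecPred q)
    (h : ∀ a, p a ↔ ∃ m, q (a, res X m)) : CE X p := by
  refine ⟨fun x => ∃ k < x.2.length + 1, q (x.1, x.2.take k), Pr.ex_lt (by fun_prop) (by fun_prop),
    ?_, fun a => (h a).trans ⟨?_, ?_⟩⟩
  · rintro a l _ ⟨t, rfl⟩ ⟨k, hk, hq⟩
    simp only at hk hq ⊢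
    refine ⟨k, by simp; omega, ?_⟩
    rwa [List.take_append_of_le_length (by omega)]
  · rintro ⟨m, hm⟩
    exact ⟨m, m, by simp, by simpa [take_res] using hm⟩
  · rintro ⟨m, k, hk, hq⟩
    simp only [length_res] at hk hq
    rw [take_res X (by omega)] at hq
    exact ⟨k, hq⟩

lemma prim {p : α → Prop} (hp : PrimrecPred p) : CE X p :=
  ⟨fun x => p x.1, by fun_prop, fun _ _ _ _ h => h, fun a => by simp⟩

lemma comp {p : α → Prop} (h : CE X p) {f : β → α} (hf : Primrec f) : CE X fun b => p (f b) := by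
  obtain ⟨q, hq, hm, h⟩ := h
  exact ⟨fun x => q (f x.1, x.2), by fun_prop, fun a => hm (f a), fun b => h (f b)⟩

lemma and {p p' : α → Prop} (h : CE X p) (h' : CE X p') : CE X fun a => p a ∧ p' a := by
  obtain ⟨q, hq, hm, h⟩ := h
  obtain ⟨q', hq', hm', h'⟩ := h'
  refine ⟨fun x => q x ∧ q' x, by fun_prop, fun a l l' hl => And.imp (hm a l l' hl) (hm' a l l' hl),
    fun a => ?_⟩
  simp only [h, h']
  constructor
  · rintro ⟨⟨m, h1⟩, n, h2⟩
    exact ⟨Max.max m n, hm _ _ _ (res_prefix X (le_max_left _ _)) h1,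
      hm' _ _ _ (res_prefix X (le_max_right _ _)) h2⟩
  · rintro ⟨m, h1, h2⟩
    exact ⟨⟨m, h1⟩, m, h2⟩

lemma or {p p' : α → Prop} (h : CE X p) (h' : CE X p') : CE X fun a => p a ∨ p' a := by
  obtain ⟨q, hq, hm, h⟩ := h
  obtain ⟨q', hq', hm', h'⟩ := h'
  refine ⟨fun x => q x ∨ q' x, by fun_prop, fun a l l' hl => Or.imp (hm a l l' hl) (hm' a l l' hl),
    fun a => ?_⟩
  simp only [h, h', exists_or]

lemma ex {p : α → β → Prop} (h : CE X fun x : α × β => p x.1 x.2) : CE X fun a => ∃ b, p a b := by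
  obtain ⟨q, hq, hm, h⟩ := h
  refine ⟨fun x => ∃ k < x.2.length, ∃ b, Encodable.decode k = some b ∧ q ((x.1, b), x.2),
    Pr.ex_lt (by fun_prop) (Pr.ex_opt (p := fun (x : (α × List Bool) × ℕ) (b : β) =>
      q ((x.1.1, b), x.1.2)) (by fun_prop) (by fun_prop)), ?_, fun a => ?_⟩
  · rintro a l l' hl ⟨k, hk, b, hb, hq⟩
    exact ⟨k, hk.trans_le hl.length_le, b, hb, hm _ _ _ hl hq⟩
  · constructor
    · rintro ⟨b, hb⟩
      obtain ⟨m, hq⟩ := (h (a, b)).1 hb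
      refine ⟨Max.max m (Encodable.encode b + 1), Encodable.encode b, ?_, b, by simp,
        hm _ _ _ (res_prefix X (le_max_left _ _)) hq⟩
      simp only [length_res]; omega
    · rintro ⟨m, k, hk, b, hb, hq⟩
      exact ⟨b, (h (a, b)).2 ⟨m, hq⟩⟩

lemma all_mem {f : α → List β} {p : α → β → Prop} (hf : Primrec f)
    (h : CE X fun x : α × β => p x.1 x.2) : CE X fun a => ∀ b ∈ f a, p a b := by
  obtain ⟨q, hq, hm, h⟩ := h
  refine ⟨fun x => ∀ b ∈ f x.1, q ((x.1, b), x.2),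
    Pr.all_mem (p := fun (x : α × List Bool) (b : β) => q ((x.1, b), x.2))
    (by fun_prop) (by fun_prop), ?_, fun a => ?_⟩
  · exact fun a l l' hl H b hb => hm _ _ _ hl (H b hb)
  · have key : (∀ b ∈ f a, ∀ᶠ m in atTop, q ((a, b), res X m)) ↔
        ∀ᶠ m in atTop, ∀ b ∈ f a, q ((a, b), res X m) := by
      have := (List.finite_toSet (f a)).eventually_all (l := atTop)
        (p := fun (b : β) (m : ℕ) => q ((a, b), res X m))
      exact this.symm
    constructor
    · intro H
      refine (key.1 fun b hb => ?_).exists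
      obtain ⟨m, hq⟩ := (h (a, b)).1 (H b hb)
      filter_upwards [eventually_ge_atTop m] with n hn
      exact hm _ _ _ (res_prefix X hn) hq
    · rintro ⟨m, H⟩ b hb
      exact (h (a, b)).2 ⟨m, H b hb⟩

lemma all_lt {f : α → ℕ} {p : α → ℕ → Prop} (hf : Primrec f)
    (h : CE X fun x : α × ℕ => p x.1 x.2) : CE X fun a => ∀ b < f a, p a b :=
  (all_mem (Pr.range hf) h).of_eq fun a => by simp

lemma isPrefix_res {f : α → List Bool} (hf : Primrec f) : CE X fun a => ∃ m, f a <+: res X m :=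
  mk' (fun x => f x.1 <+: x.2) (by fun_prop) fun _ => Iff.rfl

lemma bit_eq {f : α → ℕ} (hf : Primrec f) (b : Bool) : CE X fun a => X (f a) = b := by
  refine mk' (fun x => x.2[f x.1]? = some b) (by fun_prop) fun a => ?_
  simp only [getElem?_res]
  constructor
  · exact fun h => ⟨f a + 1, by simp [h]⟩
  · rintro ⟨m, hm⟩
    split_ifs at hm
    simpa using hm

lemma eval_eq {c : OracleCode} {f g : α → ℕ} (hf : Primrec f) (hg : Primrec g) :
    CE X fun a => g a ∈ c.eval (oracleOf X) (f a) := by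
  have h : CE X fun x : α × ℕ => ∃ m, uEval x.2 (res X m) c.encodeCode (f x.1) = some (g x.1) :=
    mk' (fun x => uEval x.1.2 x.2 c.encodeCode (f x.1.1) = some (g x.1.1)) (by fun_prop)
      fun _ => Iff.rfl
  refine (ex (p := fun a s => ∃ m, uEval s (res X m) c.encodeCode (f a) = some (g a)) h).of_eq
    fun a => ?_
  rw [mem_eval_oracleOf, exists_comm]

lemma eval_dom {c : OracleCode} {f : α → ℕ} (hf : Primrec f) :
    CE X fun a => (c.eval (oracleOf X) (f a)).Dom :=
  (ex (eval_eq (f := fun x : α × ℕ => f x.1) (g := fun x => x.2) (by fun_prop) (by fun_prop))).of_eq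
    fun _ => Part.dom_iff_mem.symm

end CE

section
open Nat.Partrec

/-- Ordinary codes as oracle codes. -/
def embed : Code → OracleCode
  | .zero => .zero
  | .succ => .succ
  | .left => .left
  | .right => .right
  | .pair cf cg => .pair (embed cf) (embed cg)
  | .comp cf cg => .comp (embed cf) (embed cg)
  | .prec cf cg => .prec (embed cf) (embed cg)
  | .rfind' cf => .rfind' (embed cf)

lemma eval_embed (O : ℕ → ℕ) (c : Code) : (embed c).eval O = c.eval := by
  induction c with
  | zero | succ | left | right => rfl
  | pair cf cg hf hg | comp cf cg hf hg | prec cf cg hf hg =>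
    simp only [embed, OracleCode.eval, Code.eval, hf, hg]; rfl
  | rfind' cf hf => simp only [embed, OracleCode.eval, Code.eval, hf]; rfl

end

namespace RecursiveIn
variable {O : ℕ → ℕ}

lemma of_primrec {f : ℕ → ℕ} (hf : Primrec f) : RecursiveIn O ↑f := by
  obtain ⟨c, hc⟩ := Nat.Partrec.Code.exists_code.1 (Nat.Partrec.of_primrec (Primrec.nat_iff.1 hf))
  exact ⟨embed c, by rw [eval_embed, hc]⟩

lemma comp {f g : ℕ → ℕ} (hf : RecursiveIn O ↑f) (hg : RecursiveIn O ↑g) :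
    RecursiveIn O ↑(fun n => f (g n)) := by
  obtain ⟨c, hc⟩ := hf
  obtain ⟨d, hd⟩ := hg
  refine ⟨.comp c d, funext fun n => ?_⟩
  change (d.eval O n >>= c.eval O) = _
  rw [hc, hd]
  exact Part.bind_some _ _

lemma pair {f g : ℕ → ℕ} (hf : RecursiveIn O ↑f) (hg : RecursiveIn O ↑g) :
    RecursiveIn O ↑(fun n => Nat.pair (f n) (g n)) := by
  obtain ⟨c, hc⟩ := hf
  obtain ⟨d, hd⟩ := hg
  refine ⟨.pair c d, funext fun n => ?_⟩
  change (Nat.pair <$> c.eval O n <*> d.eval O n : Part ℕ) = _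
  rw [hc, hd]
  change (Nat.pair <$> Part.some (f n) <*> Part.some (g n) : Part ℕ) = Part.some _
  simp [Seq.seq]

lemma prec {f g : ℕ → ℕ} (hf : RecursiveIn O ↑f) (hg : RecursiveIn O ↑g) :
    RecursiveIn O ↑(fun n : ℕ => (Nat.rec (f n.unpair.1)
      (fun y i => g (Nat.pair n.unpair.1 (Nat.pair y i))) n.unpair.2 : ℕ)) := by
  obtain ⟨c, hc⟩ := hf
  obtain ⟨d, hd⟩ := hg
  refine ⟨.prec c d, funext fun n => ?_⟩
  rw [← OracleCode.evalP_coe] at *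
  rw [← Nat.pair_unpair n]
  generalize n.unpair.1 = a
  induction n.unpair.2 with
  | zero => rw [OracleCode.evalP_prec_zero, hc]; simp
  | succ y ih =>
    ext v
    rw [OracleCode.mem_evalP_prec_succ, ih, hd]
    simp

lemma oracle : RecursiveIn O ↑O := ⟨.oracle, rfl⟩

lemma search {t : ℕ → ℕ} (ht : RecursiveIn O ↑t) : ∃ c : OracleCode, ∀ n v,
    v ∈ c.eval O n ↔ t (Nat.pair n v) = 0 ∧ ∀ j < v, t (Nat.pair n j) ≠ 0 := by
  obtain ⟨c, hc⟩ := ht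
  obtain ⟨d, hd⟩ : RecursiveIn O ↑(fun n : ℕ => Nat.pair n 0) :=
    of_primrec (show Primrec _ by fun_prop)
  refine ⟨.comp (.rfind' c) d, fun n v => ?_⟩
  rw [← OracleCode.evalP_coe] at *
  rw [OracleCode.mem_evalP_comp, hd]
  simp only [PFun.coe_val, Part.mem_some_iff, exists_eq_left, OracleCode.mem_evalP_rfind', hc,
    add_zero]
  constructor
  · rintro ⟨k, h, h2, rfl⟩
    exact ⟨h.symm, by simpa using h2⟩
  · rintro ⟨h, h2⟩
    exact ⟨v, h.symm, by simpa using h2, rfl⟩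

lemma res (X : ℕ → Bool) : RecursiveIn (oracleOf X) ↑(fun n => Encodable.encode (res X n)) := by
  let g : ℕ × ℕ → ℕ := fun p => Encodable.encode
    ((Encodable.decode (α := List Bool) p.1).getD [] ++ [decide (p.2 = 1)])
  have hg : Primrec g := by
    have h1 : Primrec fun p : ℕ × ℕ => decide (p.2 = 1) :=
      (Pr.decide (p := fun p : ℕ × ℕ => p.2 = 1) (by fun_prop)).of_eq fun _ => by congr
    simp only [g]
    fun_prop
  have h1 : RecursiveIn (oracleOf X) ↑(fun n : ℕ => g (n.unpair.2.unpair.2,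
      oracleOf X n.unpair.2.unpair.1)) := by
    have := comp (O := oracleOf X) (f := fun n => g n.unpair) (of_primrec (by fun_prop))
      (pair (f := fun n => n.unpair.2.unpair.2) (of_primrec (by fun_prop))
        (comp oracle (g := fun n => n.unpair.2.unpair.1) (of_primrec (by fun_prop))))
    simpa using this
  have h2 := comp (prec (f := fun _ => Encodable.encode ([] : List Bool))
    (of_primrec (.const _)) h1) (g := fun n => Nat.pair 0 n) (of_primrec (by fun_prop))
  convert h2 using 2
  funext n
  simp only [Nat.unpair_pair]
  induction n with
  | zero => rfl
  | succ n ih =>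
    simp only [← ih, g, Encodable.encodek, res_succ]
    congr
    generalize hb : X n = b
    have : oracleOf X n = cond b 1 0 := by rw [oracleOf, hb]
    simp only [this]
    cases b <;> rfl

lemma search_res (X : ℕ → Bool) {q : ℕ × List Bool → Prop} (hq : PrimrecPred q) :
    ∃ c : OracleCode, ∀ n v, v ∈ c.eval (oracleOf X) n ↔
      q (n, LMD.res X v) ∧ ∀ j < v, ¬ q (n, LMD.res X j) := by
  classical
  let t : ℕ → ℕ := fun n => if q (n.unpair.1,
    (Encodable.decode (α := List Bool) n.unpair.2).getD []) then 0 else 1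
  have hq' : PrimrecPred fun n : ℕ => q (n.unpair.1,
    (Encodable.decode (α := List Bool) n.unpair.2).getD []) := by fun_prop
  have ht : Primrec t := Pr.ite hq' (.const 0) (.const 1)
  obtain ⟨c, hc⟩ := search (comp (O := oracleOf X) (of_primrec ht)
    (pair (f := fun n => n.unpair.1) (of_primrec (by fun_prop))
      (comp (res X) (of_primrec (f := fun n => n.unpair.2) (by fun_prop)))))
  refine ⟨c, fun n v => ?_⟩
  simp [hc, t]

end RecursiveIn

/-- The characteristic sequence of a set. -/
noncomputable def bits (A : Set ℕ) : ℕ → Bool := by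
  classical exact fun n => decide (n ∈ A)

lemma bits_eq_true {A : Set ℕ} {n : ℕ} : bits A n = true ↔ n ∈ A := by simp [bits]

lemma oracleOf_bits (A : Set ℕ) : oracleOf (bits A) = chi A := by
  classical
  funext n
  by_cases h : n ∈ A <;> simp [oracleOf, bits, chi, h]

namespace CE
variable {α : Type*} [Primcodable α] {X : ℕ → Bool}

lemma exists_code {p : α → Prop} (h : CE X p) :
    ∃ c : OracleCode, ∀ a, p a ↔ (c.eval (oracleOf X) (Encodable.encode a)).Dom := by
  obtain ⟨q, hq, -, h⟩ := h
  have hq' : PrimrecPred fun x : ℕ × List Bool =>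
      ∃ a, Encodable.decode (α := α) x.1 = some a ∧ q (a, x.2) :=
    Pr.ex_opt (p := fun (x : ℕ × List Bool) a => q (a, x.2)) (by fun_prop) (by fun_prop)
  obtain ⟨c, hc⟩ := RecursiveIn.search_res X hq'
  refine ⟨c, fun a => ?_⟩
  simp only [Part.dom_iff_mem, hc, Encodable.encodek, Option.some.injEq, exists_eq_left', h]
  classical
  exact ⟨fun hm => ⟨Nat.find hm, Nat.find_spec hm, fun j hj => Nat.find_min hm hj⟩,
    fun ⟨m, hm, _⟩ => ⟨m, hm⟩⟩

lemma exists_selection {p : ℕ → ℕ → Prop} (h : CE X fun x : ℕ × ℕ => p x.1 x.2)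
    (hp : ∀ n, ∃ t, p n t) : ∃ f : ℕ → ℕ, RecursiveIn (oracleOf X) ↑f ∧ ∀ n, p n (f n) := by
  obtain ⟨q, hq, -, h⟩ := h
  obtain ⟨c, hc⟩ := RecursiveIn.search_res X (q := fun x : ℕ × List Bool =>
    q ((x.1, x.2.length.unpair.1), x.2.take x.2.length.unpair.2)) (by fun_prop)
  have hex : ∀ n, ∃ v : ℕ, q ((n, v.unpair.1), res X v.unpair.2) := by
    intro n
    obtain ⟨t, ht⟩ := hp n
    obtain ⟨m, hm⟩ := (h (n, t)).1 ht
    exact ⟨Nat.pair t m, by simpa using hm⟩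
  have hc' : ∀ n v : ℕ, v ∈ c.eval (oracleOf X) n ↔ q ((n, v.unpair.1), res X v.unpair.2) ∧
      ∀ j : ℕ, j < v → ¬ q ((n, j.unpair.1), res X j.unpair.2) := by
    intro n v
    rw [hc]
    simp only [length_res, take_res X (Nat.unpair_right_le _)]
  classical
  have hd : RecursiveIn (oracleOf X) ↑(fun n => Nat.find (hex n)) := by
    refine ⟨c, funext fun n => Part.ext fun v => ?_⟩
    rw [hc', PFun.coe_val, Part.mem_some_iff, eq_comm, Nat.find_eq_iff]
  refine ⟨fun n => (Nat.find (hex n)).unpair.1,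
    RecursiveIn.comp (f := fun n => n.unpair.1) (RecursiveIn.of_primrec (by fun_prop)) hd, fun n => ?_⟩
  exact (h (n, _)).2 ⟨_, Nat.find_spec (hex n)⟩

end CE

lemma ceIn_iff {A : Set ℕ} {W : Set (List Bool)} : CeIn A W ↔ CE (bits A) fun σ => σ ∈ W := by
  constructor
  · rintro ⟨c, hc⟩
    refine (CE.eval_dom (c := c) Primrec.encode).of_eq fun σ => ?_
    rw [hc, oracleOf_bits]
  · intro h
    obtain ⟨c, hc⟩ := h.exists_code
    exact ⟨c, by simpa only [oracleOf_bits] using hc⟩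

lemma ceSeqIn_iff {A : Set ℕ} {W : ℕ → Set (List Bool)} :
    CeSeqIn A W ↔ CE (bits A) fun x : ℕ × List Bool => x.2 ∈ W x.1 := by
  constructor
  · rintro ⟨c, hc⟩
    refine (CE.eval_dom (c := c)
      (f := fun x : ℕ × List Bool => Nat.pair x.1 (Encodable.encode x.2)) (by fun_prop)).of_eq
      fun σ => ?_
    rw [hc, oracleOf_bits]
  · intro h
    obtain ⟨c, hc⟩ := h.exists_code
    exact ⟨c, fun n σ => by
      have := hc (n, σ)
      rwa [oracleOf_bits] at this⟩

lemma encodeCode_surjective : Function.Surjective OracleCode.encodeCode := by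
  intro n
  induction n using Nat.strong_induction_on with
  | _ n ih =>
    by_cases h0 : n < 5
    · interval_cases n
      exacts [⟨.zero, rfl⟩, ⟨.succ, rfl⟩, ⟨.left, rfl⟩, ⟨.right, rfl⟩, ⟨.oracle, rfl⟩]
    · obtain ⟨m, r, hr, rfl⟩ : ∃ m r, r < 4 ∧ n = 4 * m + 5 + r :=
        ⟨(n - 5) / 4, (n - 5) % 4, Nat.mod_lt _ (by omega), by omega⟩
      obtain ⟨a, ha⟩ := ih m.unpair.1 (by have := Nat.unpair_left_le m; omega)
      obtain ⟨b, hb⟩ := ih m.unpair.2 (by have := Nat.unpair_right_le m; omega)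
      obtain ⟨c, hc⟩ := ih m (by omega)
      interval_cases r
      · exact ⟨.pair a b, by simp [OracleCode.encodeCode, ha, hb]⟩
      · exact ⟨.comp a b, by simp [OracleCode.encodeCode, ha, hb]⟩
      · exact ⟨.prec a b, by simp [OracleCode.encodeCode, ha, hb]⟩
      · exact ⟨.rfind' c, by simp [OracleCode.encodeCode, hc]⟩

lemma mem_jump_iff {A : Set ℕ} {c : OracleCode} :
    c.encodeCode ∈ jump A ↔ (c.eval (chi A) c.encodeCode).Dom := by
  have key : ∀ c : OracleCode, (c.eval (chi A) c.encodeCode).Dom ↔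
      ∃ v m s, uEval s (res (bits A) m) c.encodeCode c.encodeCode = some v := by
    intro c
    rw [Part.dom_iff_mem, ← oracleOf_bits]
    simp only [mem_eval_oracleOf]
  constructor
  · rintro ⟨d, hd, h⟩
    rw [← hd, key] at h
    rwa [key, ← hd]
  · exact fun h => ⟨c, rfl, h⟩

lemma ce_jump (A : Set ℕ) : CE (bits A) fun e => e ∈ jump A := by
  have h : CE (bits A) fun x : ℕ × ℕ × ℕ => ∃ m,
      uEval x.2.1 (res (bits A) m) x.1 x.1 = some x.2.2 :=
    CE.mk' (fun x => uEval x.1.2.1 x.2 x.1.1 x.1.1 = some x.1.2.2) (by fun_prop) fun _ => Iff.rfl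
  refine (CE.ex (p := fun e (x : ℕ × ℕ) => ∃ m,
    uEval x.1 (res (bits A) m) e e = some x.2) h).of_eq fun e => ?_
  obtain ⟨c, rfl⟩ := encodeCode_surjective e
  rw [mem_jump_iff, Part.dom_iff_mem, ← oracleOf_bits]
  simp only [mem_eval_oracleOf, Prod.exists]
  exact ⟨fun ⟨s, v, m, h⟩ => ⟨v, m, s, h⟩, fun ⟨v, m, s, h⟩ => ⟨s, v, m, h⟩⟩

/-- A code for the constant function. -/
def constCode : ℕ → OracleCode
  | 0 => .zero
  | n + 1 => .comp .succ (constCode n)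

lemma mem_constCode {O : ℕ →. ℕ} {n m v : ℕ} : v ∈ (constCode n).evalP O m ↔ v = n := by
  induction n generalizing v with
  | zero => exact Part.mem_some_iff
  | succ n ih =>
    rw [constCode, OracleCode.mem_evalP_comp]
    simp only [ih, exists_eq_left]
    exact Part.mem_some_iff

lemma primrec_encode_constCode : Primrec fun n => (constCode n).encodeCode := by
  refine (Pr.nat_rec (f := fun n : ℕ => n) (g := fun _ => 0)
    (h := fun _ _ k => 4 * Nat.pair 1 k + 6) (by fun_prop) (by fun_prop) (by fun_prop)).of_eq
    fun n => ?_
  induction n with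
  | zero => rfl
  | succ n ih => simp only [ih]; rfl

lemma CE.compl_jump {α : Type*} [Primcodable α] {A : Set ℕ} {p : α → Prop} (h : CE (bits A) p) :
    CE (bits (jump A)) fun a => ¬ p a := by
  obtain ⟨c, hc⟩ := h.exists_code
  let e : α → ℕ := fun a => (OracleCode.comp c (constCode (Encodable.encode a))).encodeCode
  have he : Primrec e := by
    have : Primrec fun a : α => (constCode (Encodable.encode a)).encodeCode :=
      primrec_encode_constCode.comp .encode
    simp only [e, OracleCode.encodeCode]
    fun_prop
  refine (CE.bit_eq he false).of_eq fun a => ?_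
  rw [← Bool.not_eq_true, bits_eq_true, mem_jump_iff, hc, ← oracleOf_bits, ← OracleCode.evalP_coe]
  simp only [Part.dom_iff_mem, OracleCode.mem_evalP_comp, mem_constCode, exists_eq_left]
  rw [OracleCode.evalP_coe]

lemma res_bits_empty (m : ℕ) : res (bits ∅) m = List.replicate m false := by
  have : bits ∅ = fun _ => false := by funext n; simp [bits]
  rw [this]; simp [res, List.map_const']

@[fun_prop] lemma Pr.replicate {α : Type*} [Primcodable α] {f : α → ℕ} (hf : Primrec f) (b : Bool) :
    Primrec fun a => List.replicate (f a) b :=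
  (Pr.map (g := fun _ _ => b) (Pr.range hf) (.const b)).of_eq fun a => by simp [List.map_const']

/-- Normal form of (absolutely) c.e. predicates. -/
lemma CE.exists_stages {α : Type*} [Primcodable α] {p : α → Prop} (h : CE (bits ∅) p) :
    ∃ q : α × ℕ → Prop, PrimrecPred q ∧ (∀ a m n, m ≤ n → q (a, m) → q (a, n)) ∧
      ∀ a, p a ↔ ∃ m, q (a, m) := by
  obtain ⟨q, hq, hm, h⟩ := h
  refine ⟨fun x => q (x.1, List.replicate x.2 false), by fun_prop, fun a m n hmn => hm _ _ _ ?_,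
    fun a => by simpa only [res_bits_empty] using h a⟩
  rw [← res_bits_empty, ← res_bits_empty]
  exact res_prefix _ hmn

/-- The initial segments of a set's jump have a computable approximation. -/
lemma exists_approx_jump : ∃ apx : List Bool × ℕ → Prop, PrimrecPred apx ∧
    (∀ m, ∀ᶠ t in atTop, apx (res (bits (jump ∅)) m, t)) ∧
    ∀ l, (∀ m, l ≠ res (bits (jump ∅)) m) → ∀ᶠ t in atTop, ¬ apx (l, t) := by
  obtain ⟨q, hq, hm, h⟩ := (ce_jump ∅).exists_stages
  have hev : ∀ i, ∀ᶠ t in atTop, (q (i, t) ↔ i ∈ jump ∅) := by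
    intro i
    by_cases hi : i ∈ jump ∅
    · obtain ⟨m, hm'⟩ := (h i).1 hi
      filter_upwards [eventually_ge_atTop m] with t ht
      exact iff_of_true (hm _ _ _ ht hm') hi
    · exact Eventually.of_forall fun t => iff_of_false (fun hq => hi ((h i).2 ⟨t, hq⟩)) hi
  have hev2 : ∀ n, ∀ᶠ t in atTop, ∀ i < n, (q (i, t) ↔ i ∈ jump ∅) := fun n =>
    ((Set.finite_Iio n).eventually_all (p := fun i t => (q (i, t) ↔ i ∈ jump ∅))).2 fun i _ => hev i
  refine ⟨fun x => ∀ i < x.1.length, (x.1[i]? = some true ↔ q (i, x.2)),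
    Pr.all_lt (p := fun (x : List Bool × ℕ) i => (x.1[i]? = some true ↔ q (i, x.2)))
      (by fun_prop) (by fun_prop), fun m => ?_, fun l hl => ?_⟩
  · filter_upwards [hev2 m] with t ht i hi
    simp only [length_res] at hi
    rw [ht i hi, getElem?_res, if_pos hi, Option.some_inj, bits_eq_true]
  · filter_upwards [hev2 l.length] with t ht hap
    refine hl l.length (List.ext_getElem? fun i => ?_)
    rw [getElem?_res]
    split_ifs with hi
    · have h1 := (hap i hi).trans (ht i hi)
      rw [← bits_eq_true] at h1
      simp only [List.getElem?_eq_getElem hi, Option.some_inj] at h1 ⊢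
      exact Bool.eq_iff_iff.2 h1
    · exact List.getElem?_eq_none (by omega)

lemma mem_Cyl {W : Set (List Bool)} {X : ℕ → Bool} : X ∈ Cyl W ↔ ∃ n, res X n ∈ W := by
  constructor
  · rintro ⟨σ, hσ, h⟩
    refine ⟨σ.length, ?_⟩
    convert hσ
    refine List.ext_getElem (by simp) fun i h1 h2 => ?_
    simpa [res] using h ⟨i, h2⟩
  · rintro ⟨n, h⟩
    refine ⟨_, h, fun i => ?_⟩
    rw [List.get_eq_getElem]
    simp [res]

lemma Cyl_mono {W W' : Set (List Bool)} (h : W ⊆ W') : Cyl W ⊆ Cyl W' :=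
  fun _ ⟨σ, hσ, hX⟩ => ⟨σ, h hσ, hX⟩

lemma Cyl_union (W W' : Set (List Bool)) : Cyl (W ∪ W') = Cyl W ∪ Cyl W' := by
  ext X; simp only [mem_Cyl, Set.mem_union, exists_or]

lemma isOpen_res_eq (n : ℕ) (l : List Bool) : IsOpen {X | res X n = l} := by
  by_cases h : ∃ Y, res Y n = l
  · obtain ⟨Y, rfl⟩ := h
    have : {X | res X n = res Y n} = ⋂ i ∈ Finset.range n, {X : ℕ → Bool | X i = Y i} := by
      ext X; simp [res_eq_res_iff]
    rw [this]
    exact isOpen_biInter_finset fun i _ => (isOpen_discrete ({Y i} : Set Bool)).preimage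
      (continuous_apply (A := fun _ => Bool) i)
  · convert isOpen_empty
    ext X
    exact iff_of_false (fun hX => h ⟨X, hX⟩) id

lemma isOpen_res_mem (n : ℕ) (P : List Bool → Prop) : IsOpen {X | P (res X n)} := by
  have : {X | P (res X n)} = ⋃ l ∈ {l | P l}, {X | res X n = l} := by ext X; simp
  rw [this]
  exact isOpen_biUnion fun l _ => isOpen_res_eq n l

lemma isOpen_Cyl (W : Set (List Bool)) : IsOpen (Cyl W) := by
  have : Cyl W = ⋃ n, {X | res X n ∈ W} := by ext X; simp [mem_Cyl]
  rw [this]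
  exact isOpen_iUnion fun n => isOpen_res_mem n _

lemma measurableSet_Cyl (W : Set (List Bool)) : MeasurableSet (Cyl W) := (isOpen_Cyl W).measurableSet

lemma measurableSet_res (n : ℕ) (P : List Bool → Prop) : MeasurableSet {X | P (res X n)} :=
  (isOpen_res_mem n P).measurableSet

lemma exists_res_eq {l : List Bool} : ∃ X, res X l.length = l :=
  ⟨fun n => l.getD n false, List.ext_getElem (by simp) fun i h1 h2 => by
    simp only [length_res] at h1
    simp [res, h1]⟩

lemma mu_res_eq (l : List Bool) : mu {X | res X l.length = l} = 2⁻¹ ^ l.length := by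
  obtain ⟨Y, hY⟩ := exists_res_eq (l := l)
  rw [← mu_basicCyl l.length Y]
  congr 1
  ext X
  conv_lhs => rw [Set.mem_ofPred_eq, ← hY]
  simp [res_eq_res_iff, basicCyl]

lemma mu_res_mem_le {n : ℕ} (N : List (List Bool)) :
    mu {X | res X n ∈ N} ≤ N.length * 2⁻¹ ^ n := by
  induction N with
  | nil => simp
  | cons a N ih =>
    have : {X | res X n ∈ a :: N} = {X | res X n = a} ∪ {X | res X n ∈ N} := by
      ext X; simp
    rw [this]
    refine (measure_union_le _ _).trans ?_
    rw [List.length_cons, Nat.cast_add_one, add_mul, one_mul, add_comm]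
    refine add_le_add ih ?_
    by_cases ha : a.length = n
    · subst ha; exact (mu_res_eq a).le
    · have : {X | res X n = a} = ∅ := by
        ext X
        exact iff_of_false (fun hX => ha (by rw [← show res X n = a from hX, length_res])) id
      rw [this]; simp

lemma mu_res_mem {n : ℕ} {N : List (List Bool)} (hN : N.Nodup) (hl : ∀ l ∈ N, l.length = n) :
    mu {X | res X n ∈ N} = N.length * 2⁻¹ ^ n := by
  induction N with
  | nil => simp
  | cons a N ih =>
    have : {X | res X n ∈ a :: N} = {X | res X n ∈ N} ∪ {X | res X n = a} := by
      ext X; simp [or_comm]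
    rw [this, measure_union _ (measurableSet_res n (· = a)), List.length_cons, Nat.cast_add_one,
      add_mul, one_mul, ih (List.nodup_cons.1 hN).2 fun l h => hl l (List.mem_cons_of_mem _ h)]
    · have ha := hl a (by simp)
      subst ha
      rw [mu_res_eq]
    · rw [Set.disjoint_left]
      rintro X hX (rfl : res X n = a)
      exact (List.nodup_cons.1 hN).1 hX

/-- The list of binary strings of length `n`. -/
def strs (n : ℕ) : List (List Bool) :=
  Nat.rec [[]] (fun _ L => L.flatMap fun l => [false :: l, true :: l]) n

lemma strs_succ (n : ℕ) : strs (n + 1) = (strs n).flatMap fun l => [false :: l, true :: l] := rfl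

@[simp] lemma mem_strs {n : ℕ} {l : List Bool} : l ∈ strs n ↔ l.length = n := by
  induction n generalizing l with
  | zero => simp [strs]
  | succ n ih =>
    rw [strs_succ]
    simp only [List.mem_flatMap, ih, List.mem_cons, List.not_mem_nil, or_false]
    constructor
    · rintro ⟨a, rfl, rfl | rfl⟩ <;> simp
    · intro h
      cases l with
      | nil => simp at h
      | cons b l => exact ⟨l, by simpa using h, by cases b <;> simp⟩

lemma nodup_strs (n : ℕ) : (strs n).Nodup := by
  induction n with
  | zero => simp [strs]
  | succ n ih =>
    rw [strs_succ, List.nodup_flatMap]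
    refine ⟨fun l _ => by simp, ih.imp ?_⟩
    intro a b hab
    simp [Function.onFun, Ne.symm hab]

@[fun_prop] lemma Pr.strs {α : Type*} [Primcodable α] {f : α → ℕ} (hf : Primrec f) :
    Primrec fun a => LMD.strs (f a) := by
  refine Pr.nat_rec (g := fun _ => [[]])
    (h := fun _ _ L => L.flatMap fun l => [false :: l, true :: l]) hf (.const _) ?_
  refine Primrec.list_flatMap (f := fun x : α × ℕ × List (List Bool) => x.2.2)
    (g := fun _ l => [false :: l, true :: l]) (by fun_prop) (show Primrec _ by fun_prop)

/-- A uniformly primitive recursive sequence of clopen sets. -/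
structure Clop where
  /-- The length of the initial segment deciding membership. -/
  bd : ℕ → ℕ
  /-- Membership on initial segments. -/
  dec : ℕ × List Bool → Prop
  prim_bd : Primrec bd
  prim_dec : PrimrecPred dec

namespace Clop
attribute [fun_prop] prim_bd prim_dec

/-- The `i`-th set of the sequence. -/
def set (K : Clop) (i : ℕ) : Set (ℕ → Bool) := {X | K.dec (i, res X (K.bd i))}

lemma mem_set {K : Clop} {i : ℕ} {X : ℕ → Bool} : X ∈ K.set i ↔ K.dec (i, res X (K.bd i)) := Iff.rfl

lemma measurableSet (K : Clop) (i : ℕ) : MeasurableSet (K.set i) :=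
  measurableSet_res _ fun l => K.dec (i, l)

/-- The sequence whose `i`-th member restricts the `i`-th column. -/
def col (K : Clop) : Clop where
  bd i := Nat.pair i (K.bd i)
  dec x := K.dec (x.1, (List.range (K.bd x.1)).map fun j => x.2.getD (Nat.pair x.1 j) false)
  prim_bd := by have := K.prim_bd; fun_prop
  prim_dec := by
    have := K.prim_bd
    have := K.prim_dec
    have h : Primrec fun x : ℕ × List Bool =>
        (List.range (K.bd x.1)).map fun j => x.2.getD (Nat.pair x.1 j) false :=
      Pr.map (g := fun (x : ℕ × List Bool) j => x.2.getD (Nat.pair x.1 j) false) (by fun_prop)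
        (by fun_prop)
    fun_prop

lemma col_set (K : Clop) (i : ℕ) : K.col.set i = column i ⁻¹' K.set i := by
  ext X
  simp only [mem_set, Set.mem_preimage, col]
  rw [show ((List.range (K.bd i)).map fun j =>
    (res X (Nat.pair i (K.bd i))).getD (Nat.pair i j) false) = res (column i X) (K.bd i) from ?_]
  refine List.map_congr_left fun j hj => ?_
  rw [List.mem_range] at hj
  rw [List.getD_eq_getElem?_getD, getElem?_res, if_pos (Nat.pair_lt_pair_right _ hj)]
  rfl

lemma mu_col (K : Clop) (i : ℕ) : mu (K.col.set i) = mu (K.set i) := by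
  conv_rhs => rw [← mu_map_column i]
  rw [Measure.map_apply (measurable_column i) (K.measurableSet i), col_set]

attribute [irreducible] col

end Clop

/-- Only finitely many sets of a c.e. Solovay test contain a given random sequence. -/
lemma not_mlRandom_of_infinite {A : Set ℕ} (K : Clop) {I : Set ℕ} (hI : CE (bits A) (· ∈ I))
    (hs : ∑' i : I, mu (K.set i) ≠ ∞) {X : ℕ → Bool} (hX : {i | i ∈ I ∧ X ∈ K.set i}.Infinite) :
    ¬ MLRandom A X := by
  have hbd := K.prim_bd
  have hdec := K.prim_dec
  obtain ⟨c, hc⟩ : ∃ c : ℕ, ∑' i : I, mu (K.set i) ≤ 2 ^ c := by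
    obtain ⟨c, hc⟩ := ENNReal.exists_nat_gt hs
    exact ⟨c, hc.le.trans (by exact_mod_cast c.lt_two_pow_self.le)⟩
  let W : ℕ → Set (List Bool) := fun n => {σ | ∃ M : List ℕ, M.Nodup ∧ 2 ^ (n + c) ≤ M.length ∧
    ∀ i ∈ M, i ∈ I ∧ K.bd i ≤ σ.length ∧ K.dec (i, σ.take (K.bd i))}
  have hW : CE (bits A) fun x : ℕ × List Bool => x.2 ∈ W x.1 := by
    refine CE.ex (p := fun (x : ℕ × List Bool) (M : List ℕ) => M.Nodup ∧
      2 ^ (x.1 + c) ≤ M.length ∧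
      ∀ i ∈ M, i ∈ I ∧ K.bd i ≤ x.2.length ∧ K.dec (i, x.2.take (K.bd i))) ?_
    refine (CE.prim ?_).and ((CE.prim (by fun_prop)).and (CE.all_mem (p := fun
      (y : (ℕ × List Bool) × List ℕ) i => i ∈ I ∧ K.bd i ≤ y.1.2.length ∧
        K.dec (i, y.1.2.take (K.bd i))) (by fun_prop) ((hI.comp .snd).and (CE.prim (by fun_prop)))))
    refine (Pr.all_lt (f := fun y : (ℕ × List Bool) × List ℕ => y.2.length)
      (p := fun y j => ∀ i < j, y.2[i]? ≠ y.2[j]?) (by fun_prop)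
      (Pr.all_lt (p := fun (z : ((ℕ × List Bool) × List ℕ) × ℕ) i => z.1.2[i]? ≠ z.1.2[z.2]?)
        (by fun_prop) (PrimrecPred.not (by fun_prop)))).of_eq fun y => ?_
    rw [List.nodup_iff_getElem?_ne_getElem?]
    exact ⟨fun h i j hij hj => h j hj i hij, fun h j hj i hij => h i j hij hj⟩
  intro hR
  refine hR (fun n => Cyl (W n)) ⟨W, ceSeqIn_iff.2 hW, fun n => rfl, fun n => Cyl_mono ?_,
    fun n => ?_⟩ (Set.mem_iInter.2 fun n => ?_)
  · rintro σ ⟨M, h1, h2, h3⟩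
    exact ⟨M, h1, (Nat.pow_le_pow_right (by simp) (by omega)).trans h2, h3⟩
  · let F : (ℕ → Bool) → ℝ≥0∞ := fun X => ∑' i : I, (K.set i).indicator 1 X
    have hF : ∫⁻ X, F X ∂mu = ∑' i : I, mu (K.set i) := by
      rw [lintegral_tsum (f := fun (i : I) => (K.set i).indicator 1)
          fun i => (measurable_one.indicator (K.measurableSet i)).aemeasurable]
      exact tsum_congr fun i => lintegral_indicator_one (K.measurableSet i)
    have hsub : Cyl (W n) ⊆ {X | (2 ^ (n + c) : ℝ≥0∞) ≤ F X} := by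
      intro Y hY
      obtain ⟨m, M, h1, h2, h3⟩ := mem_Cyl.1 hY
      have h4 : ∀ i ∈ M, i ∈ I ∧ Y ∈ K.set i := fun i hi => by
        obtain ⟨a, b, h⟩ := h3 i hi
        rw [length_res] at b
        rw [take_res Y b] at h
        exact ⟨a, h⟩
      have h5 : (M.toFinset.card : ℝ≥0∞) ≤ F Y := by
        simp only [F]
        rw [tsum_subtype I fun i => (K.set i).indicator (1 : (ℕ → Bool) → ℝ≥0∞) Y]
        refine le_trans (le_of_eq ?_) (ENNReal.sum_le_tsum M.toFinset)
        rw [Finset.card_eq_sum_ones, Nat.cast_sum]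
        refine Finset.sum_congr rfl fun i hi => ?_
        obtain ⟨a, b⟩ := h4 i (List.mem_toFinset.1 hi)
        simp [a, b]
      refine le_trans ?_ h5
      rw [List.toFinset_card_of_nodup h1]
      exact_mod_cast h2
    have h6 := (mul_meas_ge_le_lintegral₀ (μ := mu) (f := F) (AEMeasurable.tsum fun i : I =>
      (measurable_one.indicator (K.measurableSet i)).aemeasurable) (2 ^ (n + c)))
    rw [hF] at h6
    have h7 : 2 ^ (n + c) * mu (Cyl (W n)) ≤ 2 ^ c :=
      (mul_le_mul_right (measure_mono hsub) _).trans (h6.trans hc)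
    have h8 : mu (Cyl (W n)) ≤ 2 ^ c / 2 ^ (n + c) := by
      rw [ENNReal.le_div_iff_mul_le (by simp) (by simp)]; rwa [mul_comm]
    refine h8.trans (le_of_eq ?_)
    rw [pow_add, ← ENNReal.inv_pow, div_eq_mul_inv, ENNReal.mul_inv (by simp) (by simp), mul_comm,
      mul_assoc, ENNReal.inv_mul_cancel (by simp) (by simp), mul_one]
  · obtain ⟨t, ht, hcard⟩ := hX.exists_subset_card_eq (2 ^ (n + c))
    refine mem_Cyl.2 ⟨t.sup K.bd, t.toList, t.nodup_toList, by simp [hcard], fun i hi => ?_⟩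
    have hi' := Finset.mem_toList.1 hi
    have hle : K.bd i ≤ t.sup K.bd := Finset.le_sup hi'
    obtain ⟨a, b⟩ := ht hi'
    exact ⟨a, by simpa using hle, by rw [take_res X hle]; exact b⟩

lemma natCast_mul_inv_pow_le {a m n : ℕ} :
    (a : ℝ≥0∞) * 2⁻¹ ^ m ≤ 2⁻¹ ^ n ↔ a * 2 ^ n ≤ 2 ^ m := by
  rw [← ENNReal.inv_pow, ← ENNReal.inv_pow, ← div_eq_mul_inv,
    ENNReal.div_le_iff (by simp) (by simp), mul_comm, ← div_eq_mul_inv,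
    ENNReal.le_div_iff_mul_le (by simp) (by simp)]
  exact_mod_cast Iff.rfl

lemma isPrefix_res_iff {σ : List Bool} {X : ℕ → Bool} {n : ℕ} :
    σ <+: res X n ↔ res X σ.length = σ ∧ σ.length ≤ n := by
  constructor
  · intro h
    exact ⟨(eq_res_of_prefix h).symm, by simpa using h.length_le⟩
  · rintro ⟨h, h'⟩
    rw [← h]
    exact res_prefix X (by simpa using h')

/-- Countable additivity argument behind the second Borel-Cantelli lemma, along the columns. -/
lemma tsum_ne_top_of_col (K : Clop) {J : Set ℕ} {Q : Set (ℕ → Bool)}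
    (h : ∑' i : J, mu (K.col.set i ∩ Q) < mu Q) : ∑' i : J, mu (K.set i) ≠ ∞ := by
  classical
  intro htop
  let t : ℕ → Set (ℕ → Bool) := fun n => if n ∈ J then K.set n else ∅
  let s : ℕ → Set (ℕ → Bool) := fun n => column n ⁻¹' t n
  have ht : ∀ n, MeasurableSet (t n) := fun n => by
    simp only [t]; split_ifs
    · exact K.measurableSet n
    · exact .empty
  have hs : ∀ n, MeasurableSet (s n) := fun n => measurable_column n (ht n)
  have hind : ProbabilityTheory.iIndepSet s mu := by
    rw [ProbabilityTheory.iIndepSet_iff_meas_biInter hs]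
    intro S
    exact iIndepFun_column.measure_inter_preimage_eq_mul S fun i _ => ht i
  have hsum : ∑' n, mu (s n) = ∞ := by
    rw [← htop, tsum_subtype J fun i => mu (K.set i)]
    refine tsum_congr fun n => ?_
    by_cases hn : n ∈ J
    · simp only [s, t, hn, if_true, Set.indicator_of_mem, ← K.col_set, K.mu_col]
    · simp [s, t, hn]
  have hlim := ProbabilityTheory.measure_limsup_eq_one hs hind hsum
  have hae : ∀ᵐ X ∂mu, X ∈ limsup s atTop := by
    rw [← prob_compl_eq_zero_iff (MeasurableSet.measurableSet_limsup hs)] at hlim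
    exact hlim
  have hle : mu Q ≤ mu (⋃ i : J, K.col.set i ∩ Q) := by
    refine measure_mono_ae ?_
    filter_upwards [hae] with X hX hXQ
    rw [limsup_eq_iInf_iSup_of_nat] at hX
    simp only [Set.iInf_eq_iInter, Set.iSup_eq_iUnion, Set.mem_iInter, Set.mem_iUnion] at hX
    obtain ⟨n, -, hn⟩ := hX 0
    by_cases hnJ : n ∈ J
    · refine Set.mem_iUnion.2 ⟨⟨n, hnJ⟩, ?_, hXQ⟩
      rw [K.col_set]
      simpa [s, t, hnJ] using hn
    · simp [s, t, hnJ] at hn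
  exact (hle.trans (measure_iUnion_le _)).not_gt h

lemma exists_stage_measure_lt (W : Set (List Bool)) {S : Set (ℕ → Bool)} (hS : MeasurableSet S)
    (h : mu (S ∩ (Cyl W)ᶜ) = 0) {ε : ℝ≥0∞} (hε : 0 < ε) :
    ∃ M : List (List Bool), (∀ σ ∈ M, σ ∈ W) ∧ mu (S ∩ (Cyl {σ | σ ∈ M})ᶜ) < ε := by
  classical
  let M : ℕ → List (List Bool) := fun k =>
    ((List.range k).filterMap fun i => Encodable.decode₂ (List Bool) i).filter fun σ => decide (σ ∈ W)
  have hM : ∀ k σ, σ ∈ M k ↔ Encodable.encode σ < k ∧ σ ∈ W := by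
    intro k σ
    simp only [M, List.mem_filter, List.mem_filterMap, List.mem_range, decide_eq_true_eq]
    refine and_congr_left fun _ => ⟨?_, fun h => ⟨_, h, Encodable.encodek₂ σ⟩⟩
    rintro ⟨i, hi, h⟩
    rwa [Encodable.mem_decode₂.1 h]
  have hanti : Antitone fun k => S ∩ (Cyl {σ | σ ∈ M k})ᶜ := by
    intro k k' hk
    refine Set.inter_subset_inter_right _ (Set.compl_subset_compl.2 (Cyl_mono fun σ hσ => ?_))
    exact (hM _ _).2 ⟨((hM _ _).1 hσ).1.trans_le hk, ((hM _ _).1 hσ).2⟩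
  have hlim := tendsto_measure_iInter_atTop (μ := mu)
    (fun k => (hS.inter (measurableSet_Cyl {σ | σ ∈ M k}).compl).nullMeasurableSet) hanti
    ⟨0, measure_ne_top _ _⟩
  have hset : ⋂ k, S ∩ (Cyl {σ | σ ∈ M k})ᶜ = S ∩ (Cyl W)ᶜ := by
    rw [← Set.inter_iInter, ← Set.compl_iUnion]
    congr 2
    refine Set.Subset.antisymm (Set.iUnion_subset fun k => Cyl_mono fun σ hσ => ((hM _ _).1 hσ).2) ?_
    rintro X ⟨σ, hσ, hX⟩
    exact Set.mem_iUnion.2 ⟨_, σ, (hM (Encodable.encode σ + 1) σ).2 ⟨Nat.lt_succ_self _, hσ⟩, hX⟩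
  rw [hset, h] at hlim
  obtain ⟨k, hk⟩ := (hlim.eventually (gt_mem_nhds hε)).exists
  exact ⟨M k, fun σ hσ => ((hM _ _).1 hσ).2, hk⟩

/-- If `W` is c.e. in `B` and its complement has positive measure, then the indices of columns
that are almost disjoint from this complement are covered by a summable c.e. set. -/
lemma exists_summable_cover (K : Clop) {B : Set ℕ} {W : Set (List Bool)}
    (hW : CE (bits B) (· ∈ W)) (hpos : 0 < mu (Cyl W)ᶜ) :
    ∃ J : Set ℕ, CE (bits B) (· ∈ J) ∧ ∑' i : J, mu (K.set i) ≠ ∞ ∧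
      ∀ i, mu (K.col.set i ∩ (Cyl W)ᶜ) = 0 → i ∈ J := by
  classical
  have hbd := K.col.prim_bd
  have hdec := K.col.prim_dec
  obtain ⟨c, hc⟩ : ∃ c : ℕ, 2 * (2⁻¹ : ℝ≥0∞) ^ c < mu (Cyl W)ᶜ := by
    have h : Tendsto (fun c : ℕ => 2 * (2⁻¹ : ℝ≥0∞) ^ c) atTop (nhds (2 * 0)) :=
      ENNReal.Tendsto.const_mul (ENNReal.tendsto_pow_atTop_nhds_zero_of_lt_one (by simp)) (by simp)
    rw [mul_zero] at h
    exact (h.eventually (gt_mem_nhds hpos)).exists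
  let P : ℕ × List (List Bool) × List (List Bool) × ℕ → Prop := fun x =>
    (∀ σ ∈ x.2.1, σ ∈ W) ∧ x.2.2.1.length * 2 ^ (x.1 + c) ≤ 2 ^ x.2.2.2 ∧
      K.col.bd x.1 ≤ x.2.2.2 ∧ ∀ τ ∈ strs x.2.2.2, K.col.dec (x.1, τ.take (K.col.bd x.1)) →
        τ ∈ x.2.2.1 ∨ ∃ σ ∈ x.2.1, σ <+: τ
  let J : Set ℕ := {i | ∃ y, P (i, y)}
  have hJ : CE (bits B) (· ∈ J) := by
    refine CE.ex (p := fun i y => P (i, y)) ?_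
    refine (CE.all_mem (f := fun x : ℕ × List (List Bool) × List (List Bool) × ℕ => x.2.1)
      (p := fun _ σ => σ ∈ W) (by fun_prop) (hW.comp .snd)).and
      ((CE.prim (by fun_prop)).and ((CE.prim (by fun_prop)).and (CE.prim ?_)))
    refine Pr.all_mem (f := fun x : ℕ × List (List Bool) × List (List Bool) × ℕ => strs x.2.2.2)
      (p := fun x τ => K.col.dec (x.1, τ.take (K.col.bd x.1)) →
        τ ∈ x.2.2.1 ∨ ∃ σ ∈ x.2.1, σ <+: τ) (by fun_prop) ?_
    refine Pr.imp (by fun_prop) (PrimrecPred.or (by fun_prop) (Pr.ex_mem (f := fun x :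
      (ℕ × List (List Bool) × List (List Bool) × ℕ) × List Bool => x.1.2.1)
      (p := fun x σ => σ <+: x.2) (by fun_prop) (by fun_prop)))
  have hsmall : ∀ i ∈ J, mu (K.col.set i ∩ (Cyl W)ᶜ) ≤ 2⁻¹ ^ (i + c) := by
    rintro i ⟨⟨M, N, L⟩, h1, h2, h3, h4⟩
    dsimp only at h1 h2 h3 h4
    refine (measure_mono ?_).trans ((mu_res_mem_le (n := L) N).trans (natCast_mul_inv_pow_le.2 h2))
    rintro X ⟨hX, hXW⟩
    refine (h4 (res X L) (by simp) ?_).resolve_right ?_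
    · rw [take_res X h3]; exact hX
    · rintro ⟨σ, hσ, hσX⟩
      exact hXW (mem_Cyl.2 ⟨_, by rw [(isPrefix_res_iff.1 hσX).1]; exact h1 σ hσ⟩)
  refine ⟨J, hJ, tsum_ne_top_of_col K (lt_of_le_of_lt ?_ hc), ?_⟩
  · calc ∑' i : J, mu (K.col.set i ∩ (Cyl W)ᶜ) ≤ ∑' i : J, 2⁻¹ ^ ((i : ℕ) + c) :=
          ENNReal.tsum_le_tsum fun i => hsmall i i.2
      _ ≤ ∑' i : ℕ, (2⁻¹ : ℝ≥0∞) ^ (i + c) :=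
          ENNReal.tsum_comp_le_tsum_of_injective Subtype.val_injective _
      _ = 2 * 2⁻¹ ^ c := by
          simp_rw [pow_add]
          rw [ENNReal.tsum_mul_right, ENNReal.tsum_geometric, ENNReal.one_sub_inv_two, inv_inv]
  · intro i hi
    obtain ⟨M, hM, hlt⟩ := exists_stage_measure_lt W (K.col.measurableSet i) hi
      (ε := 2⁻¹ ^ (i + c)) (by simp [pos_iff_ne_zero])
    let L := max (K.col.bd i) ((M.map List.length).sum)
    have hML : ∀ σ ∈ M, σ.length ≤ L := fun σ hσ =>
      (List.le_sum_of_mem (List.mem_map_of_mem hσ)).trans (le_max_right _ _)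
    let N := (strs L).filter fun τ =>
      decide (K.col.dec (i, τ.take (K.col.bd i)) ∧ ¬ ∃ σ ∈ M, σ <+: τ)
    refine ⟨(M, N, L), hM, ?_, le_max_left _ _, fun τ hτ h => ?_⟩
    · dsimp only
      rw [← natCast_mul_inv_pow_le, ← mu_res_mem ((nodup_strs L).filter _)
        fun l hl => mem_strs.1 (List.mem_of_mem_filter hl)]
      refine (measure_mono ?_).trans hlt.le
      intro X hX
      have hX' : res X L ∈ N := hX
      obtain ⟨-, h⟩ := List.mem_filter.1 hX'
      obtain ⟨h1, h2⟩ := of_decide_eq_true h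
      rw [take_res X (le_max_left _ _)] at h1
      refine ⟨h1, fun hc => ?_⟩
      obtain ⟨n, hn⟩ := mem_Cyl.1 hc
      exact h2 ⟨_, hn, res_prefix X (by simpa using hML _ hn)⟩
    · dsimp only
      by_cases hp : ∃ σ ∈ M, σ <+: τ
      · exact .inr hp
      · exact .inl (List.mem_filter.2 ⟨hτ, by simp only [decide_eq_true_eq]; exact ⟨h, hp⟩⟩)

lemma tsum_union_lt_ne_top {K : Clop} {J : Set ℕ} (hJ : ∑' i : J, mu (K.set i) ≠ ∞) (k : ℕ) :
    ∑' i : ↥(J ∪ {i | i < k}), mu (K.set i) ≠ ∞ := by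
  refine ((ENNReal.tsum_union_le (fun i => mu (K.set i)) J {i | i < k}).trans_lt ?_).ne
  have : Fintype {i | i < k} := Set.fintypeLTNat k
  rw [tsum_fintype (fun b : {i | i < k} => mu (K.set b))]
  exact ENNReal.add_lt_top.2 ⟨hJ.lt_top, ENNReal.sum_lt_top.2 fun i _ => measure_lt_top _ _⟩

lemma Clop.compl_set (K : Clop) (i : ℕ) :
    (K.set i)ᶜ = Cyl {σ | K.bd i ≤ σ.length ∧ ¬ K.dec (i, σ.take (K.bd i))} := by
  ext X
  rw [mem_Cyl]
  constructor
  · intro h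
    exact ⟨K.bd i, by simp, by rw [take_res X le_rfl]; exact h⟩
  · rintro ⟨n, h1, h2⟩ h
    rw [length_res] at h1
    rw [take_res X h1] at h2
    exact h2 h

lemma eval_congr {c c' : OracleCode} (h : c.encodeCode = c'.encodeCode) (B : Set ℕ) :
    c.eval (chi B) = c'.eval (chi B) := by
  rw [← oracleOf_bits]
  funext n
  exact Part.ext fun v => by rw [mem_eval_oracleOf, mem_eval_oracleOf, h]

lemma exists_forcing_step {K : Clop} {B I : Set ℕ}
    (hno : ∀ J, CE (bits B) (· ∈ J) → I ⊆ J → ∑' i : J, mu (K.set i) = ∞)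
    {V : ℕ → Set (List Bool)} (hV : ∀ n, CE (bits B) (· ∈ V n)) (k : ℕ) {W : Set (List Bool)}
    (hW : CE (bits B) (· ∈ W)) (hpos : 0 < mu (Cyl W)ᶜ) :
    ∃ W', (CE (bits B) (· ∈ W') ∧ 0 < mu (Cyl W')ᶜ) ∧ W ⊆ W' ∧
      (∃ i ∈ I, k ≤ i ∧ (Cyl W')ᶜ ⊆ K.col.set i) ∧
      ((∀ n, mu (Cyl (V n)) ≤ 2⁻¹ ^ n) → ∃ n, Cyl (V n) ⊆ Cyl W') := by
  have hbd := K.col.prim_bd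
  have hdec := K.col.prim_dec
  obtain ⟨J, hJ, hJs, hcov⟩ := exists_summable_cover K hW hpos
  obtain ⟨i, hiI, hiJ⟩ : ∃ i ∈ I, i ∉ J ∪ {i | i < k} := by
    by_contra! h
    exact tsum_union_lt_ne_top hJs k (hno _ (hJ.or (CE.prim (by fun_prop : PrimrecPred fun i => i < k))) h)
  obtain ⟨hiJ, hik⟩ := not_or.1 hiJ
  let W₁ := W ∪ {σ | K.col.bd i ≤ σ.length ∧ ¬ K.col.dec (i, σ.take (K.col.bd i))}
  have hW₁ : CE (bits B) (· ∈ W₁) :=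
    hW.or (CE.prim (by fun_prop : PrimrecPred fun σ : List Bool =>
      K.col.bd i ≤ σ.length ∧ ¬ K.col.dec (i, σ.take (K.col.bd i))))
  have hC : (Cyl W₁)ᶜ = K.col.set i ∩ (Cyl W)ᶜ := by
    rw [Cyl_union, ← Clop.compl_set, Set.compl_union, compl_compl, Set.inter_comm]
  have hpos₁ : 0 < mu (Cyl W₁)ᶜ := by
    rw [hC]
    exact pos_iff_ne_zero.2 fun h => hiJ (hcov i h)
  have hsub₁ : (Cyl W₁)ᶜ ⊆ K.col.set i := hC ▸ Set.inter_subset_left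
  by_cases hb : ∀ n, mu (Cyl (V n)) ≤ 2⁻¹ ^ n
  · obtain ⟨n, hn⟩ := ((ENNReal.tendsto_pow_atTop_nhds_zero_of_lt_one (r := 2⁻¹)
      (by simp)).eventually (gt_mem_nhds hpos₁)).exists
    have hC₂ : (Cyl (W₁ ∪ V n))ᶜ = (Cyl W₁)ᶜ \ Cyl (V n) := by
      rw [Cyl_union, Set.compl_union]; rfl
    refine ⟨W₁ ∪ V n, ⟨hW₁.or (hV n), ?_⟩, Set.subset_union_left.trans Set.subset_union_left,
      ⟨i, hiI, not_lt.1 hik, ?_⟩, fun _ => ⟨n, Cyl_mono Set.subset_union_right⟩⟩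
    · rw [hC₂]
      exact (tsub_pos_of_lt ((hb n).trans_lt hn)).trans_le le_measure_sdiff
    · rw [hC₂]
      exact Set.sdiff_subset.trans hsub₁
  · exact ⟨W₁, ⟨hW₁, hpos₁⟩, Set.subset_union_left, ⟨i, hiI, not_lt.1 hik, hsub₁⟩,
      fun h => absurd h hb⟩

/-- If `A ≤_LR B` then summable `A`-c.e. sets of clopen sets are covered by
summable `B`-c.e. ones. -/
lemma LRle.exists_cover {A B : Set ℕ} (h : LRle A B) (K : Clop) {I : Set ℕ}
    (hI : CE (bits A) (· ∈ I)) (hs : ∑' i : I, mu (K.set i) ≠ ∞) :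
    ∃ J, CE (bits B) (· ∈ J) ∧ I ⊆ J ∧ ∑' i : J, mu (K.set i) ≠ ∞ := by
  by_contra! hno
  choose code hcode using encodeCode_surjective
  let V : ℕ → ℕ → Set (List Bool) := fun k n =>
    {σ | ((code k).eval (chi B) (Nat.pair n (Encodable.encode σ))).Dom}
  have hV : ∀ k n, CE (bits B) (· ∈ V k n) := fun k n =>
    ceIn_iff.1 ((ceIn_iff).2 ((ceSeqIn_iff.1 ⟨code k, fun _ _ => Iff.rfl⟩ :
      CE (bits B) fun x : ℕ × List Bool => x.2 ∈ V k x.1).comp (Primrec.pair (.const n) .id)))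
  let G := {W : Set (List Bool) // CE (bits B) (· ∈ W) ∧ 0 < mu (Cyl W)ᶜ}
  have step := fun (k : ℕ) (W : G) => exists_forcing_step hno (hV k) k W.2.1 W.2.2
  choose F hF1 hF2 hF3 hF4 using step
  let W : ℕ → G := fun k => Nat.rec
    ⟨∅, CE.prim (by simpa using Pr.constP False), by simp [Cyl]⟩
    (fun k g => ⟨F k g, hF1 k g⟩) k
  have hWs : ∀ k, (W (k + 1)).1 = F k (W k) := fun k => rfl
  have hclosed : ∀ k, IsClosed (Cyl (W k).1)ᶜ := fun k => (isOpen_Cyl _).isClosed_compl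
  obtain ⟨X, hX⟩ := IsCompact.nonempty_iInter_of_sequence_nonempty_isCompact_isClosed
    (fun k => (Cyl (W k).1)ᶜ)
    (fun k => Set.compl_subset_compl.2 (Cyl_mono (by rw [hWs]; exact hF2 k (W k))))
    (fun k => nonempty_of_measure_ne_zero (W k).2.2.ne') (hclosed 0).isCompact hclosed
  rw [Set.mem_iInter] at hX
  have hXB : MLRandom B X := by
    rintro U ⟨V', ⟨c, hc⟩, hU, -, hm⟩ hXU
    obtain ⟨k, hk⟩ : ∃ k, k = c.encodeCode := ⟨_, rfl⟩
    have hVk : ∀ n, V k n = V' n := fun n => by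
      ext σ; rw [hc, ← eval_congr ((hcode k).trans hk)]; rfl
    obtain ⟨n, hn⟩ := hF4 k (W k) fun n => by rw [hVk, ← hU]; exact hm n
    have hXn := Set.mem_iInter.1 hXU n
    rw [hU, ← hVk] at hXn
    exact hX (k + 1) (by rw [hWs]; exact hn hXn)
  refine not_mlRandom_of_infinite K.col hI (by simpa only [K.mu_col] using hs)
    (Set.infinite_of_forall_exists_gt fun k => ?_) (h X hXB)
  obtain ⟨i, hi, hki, hsub⟩ := hF3 (k + 1) (W (k + 1))
  exact ⟨i, ⟨hi, hsub (by rw [← hWs]; exact hX (k + 2))⟩, hki⟩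

/-- The code of the pair of `r` and the initial segment of `D` of length `m`. -/
noncomputable def stageIdx (D : Set ℕ) (r m : ℕ) : ℕ :=
  Nat.pair r (Encodable.encode (res (bits D) m))

lemma stageIdx_injective (D : Set ℕ) :
    Function.Injective fun x : ℕ × ℕ => stageIdx D x.1 x.2 := by
  rintro ⟨r, m⟩ ⟨r', m'⟩ h
  obtain ⟨h1, h2⟩ := Nat.pair_eq_pair.1 h
  have h3 := congrArg List.length (Encodable.encode_injective h2)
  simp only [length_res] at h3
  exact Prod.ext h1 h3

lemma ce_range_stageIdx (D : Set ℕ) :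
    CE (bits D) (· ∈ Set.range fun x : ℕ × ℕ => stageIdx D x.1 x.2) := by
  refine (CE.ex (p := fun (i : ℕ) (x : ℕ × List Bool) =>
    i = Nat.pair x.1 (Encodable.encode x.2) ∧ ∃ m, x.2 <+: res (bits D) m)
    ((CE.prim (Pr.eq .fst (by
      have := Primrec.encode (α := List Bool)
      fun_prop))).and (CE.isPrefix_res (by fun_prop)))).of_eq fun i => ?_
  constructor
  · rintro ⟨⟨r, l⟩, rfl, m, hm⟩
    exact ⟨(r, l.length), by simp only [stageIdx, ← eq_res_of_prefix hm]⟩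
  · rintro ⟨⟨r, m⟩, rfl⟩
    exact ⟨(r, res (bits D) m), rfl, m, List.prefix_refl _⟩

/-- A uniformly `D`-c.e. sequence of open sets splits into clopen sets indexed by the initial
segments of `D`. -/
lemma exists_stage_sets {D : Set ℕ} {W : ℕ → Set (List Bool)}
    (hW : CE (bits D) fun x : ℕ × List Bool => x.2 ∈ W x.1) :
    ∃ K : Clop, ∀ r, (⋃ m, K.set (stageIdx D r m) = Cyl (W r)) ∧
      ∑' m, mu (K.set (stageIdx D r m)) = mu (Cyl (W r)) := by
  obtain ⟨q, hq, hmono, hiff⟩ := hW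
  let dc : ℕ → List Bool := fun i => (Encodable.decode (α := List Bool) i.unpair.2).getD []
  have hdc : Primrec dc := by
    have := Primrec.decode (α := List Bool)
    fun_prop
  have hdc' : ∀ r m, dc (stageIdx D r m) = res (bits D) m := fun r m => by simp [dc, stageIdx]
  let K : Clop :=
    { bd := fun i => (dc i).length
      dec := fun x => (∃ j < (dc x.1).length, q ((x.1.unpair.1, x.2.take j), dc x.1)) ∧
        ¬ ∃ j < (dc x.1).dropLast.length, q ((x.1.unpair.1, x.2.take j), (dc x.1).dropLast)
      prim_bd := by fun_prop
      prim_dec := (Pr.ex_lt (p := fun (x : ℕ × List Bool) j =>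
          q ((x.1.unpair.1, x.2.take j), dc x.1)) (by fun_prop) (by fun_prop)).and
        (Pr.ex_lt (p := fun (x : ℕ × List Bool) j =>
          q ((x.1.unpair.1, x.2.take j), (dc x.1).dropLast)) (by fun_prop) (by fun_prop)).not }
  refine ⟨K, fun r => ?_⟩
  let v : ℕ → Set (ℕ → Bool) := fun m => {X | ∃ j < m, q ((r, res X j), res (bits D) m)}
  have hv : ∀ m, MeasurableSet (v m) := fun m => by
    have : v m = ⋃ j ∈ {j | j < m}, {X | q ((r, res X j), res (bits D) m)} := by
      ext X; simp [v]
    rw [this]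
    exact .biUnion (Set.to_countable _) fun j _ =>
      measurableSet_res j fun l => q ((r, l), res (bits D) m)
  have hvm : Monotone v := by
    rintro m m' h X ⟨j, hj, hqj⟩
    exact ⟨j, hj.trans_le h, hmono _ _ _ (res_prefix _ h) hqj⟩
  have hun : ∀ m, (stageIdx D r m).unpair.1 = r := fun m => by simp [stageIdx]
  have hK : ∀ m, K.set (stageIdx D r m) = v m \ {X | ∃ j < m - 1,
      q ((r, res X j), (res (bits D) m).dropLast)} := by
    intro m
    ext X
    have h : ∀ j < m, (res X m).take j = res X j := fun j hj => take_res X hj.le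
    simp only [Clop.mem_set, K, hdc', length_res, List.length_dropLast, v, Set.mem_sdiff,
      Set.mem_ofPred_eq, hun]
    refine and_congr (exists_congr fun j => and_congr_right fun hj => ?_)
      (not_congr (exists_congr fun j => and_congr_right fun hj => ?_))
    · rw [h j hj]
    · rw [h j (by omega)]
  have hK' : ∀ m, K.set (stageIdx D r m) = disjointed v m := by
    intro m
    rw [hK]
    cases m with
    | zero => simp [v]
    | succ m =>
      rw [← Nat.succ_eq_add_one, ← Nat.succ_eq_succ, hvm.disjointed_succ (not_isMax m)]
      simp [v, res_succ]
  simp_rw [hK']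
  have hU : ⋃ m, disjointed v m = Cyl (W r) := by
    rw [iUnion_disjointed]
    ext X
    simp only [v, Set.mem_iUnion, mem_Cyl, Set.mem_ofPred_eq]
    constructor
    · rintro ⟨m, j, -, h⟩
      exact ⟨j, (hiff (r, res X j)).2 ⟨m, h⟩⟩
    · rintro ⟨j, h⟩
      obtain ⟨m, hm⟩ := (hiff (r, res X j)).1 h
      exact ⟨m + j + 1, j, by omega, hmono _ _ _ (res_prefix _ (by omega)) hm⟩
  refine ⟨hU, ?_⟩
  rw [← hU, measure_iUnion (disjoint_disjointed v) fun m => .disjointed hv m]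

lemma tsum_range_stageIdx (D : Set ℕ) (g : ℕ → ℝ≥0∞) :
    ∑' i : Set.range fun x : ℕ × ℕ => stageIdx D x.1 x.2, g i =
      ∑' r, ∑' m, g (stageIdx D r m) := by
  rw [tsum_range g (stageIdx_injective D), ENNReal.tsum_prod (f := fun r m => g (stageIdx D r m))]

namespace Clop

/-- The sequence obtained by prefixing `r` zeros to the sets whose index has first component `r`. -/
def shift (K : Clop) : Clop where
  bd i := i.unpair.1 + K.bd i
  dec x := (∀ j < x.1.unpair.1, x.2.getD j false = false) ∧ K.dec (x.1, x.2.drop x.1.unpair.1)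
  prim_bd := by have := K.prim_bd; fun_prop
  prim_dec := by
    have := K.prim_dec
    exact (Pr.all_lt (p := fun (x : ℕ × List Bool) j => x.2.getD j false = false)
      (by fun_prop) (by fun_prop)).and (by fun_prop)

lemma mu_shift (K : Clop) (i : ℕ) :
    mu (K.shift.set i) = 2⁻¹ ^ i.unpair.1 * mu (K.set i) := by
  rw [← mu_prepend _ (K.measurableSet i)]
  congr 1
  ext X
  simp only [mem_set, shift, Set.mem_ofPred_eq]
  refine and_congr (forall₂_congr fun j hj => ?_) ?_
  · rw [List.getD_eq_getElem?_getD, getElem?_res, if_pos (by omega)]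
    rfl
  · rw [show (res X (i.unpair.1 + K.bd i)).drop i.unpair.1 =
      res (fun j => X (i.unpair.1 + j)) (K.bd i) from ?_]
    simp [res, List.range_add]

attribute [irreducible] shift

end Clop

lemma exists_string_stages {W : ℕ → Set (List Bool)}
    (hW : CE (bits ∅) fun x : ℕ × List Bool => x.2 ∈ W x.1) :
    ∃ T : ℕ × List Bool → Prop, PrimrecPred T ∧
      (∀ n l l', l <+: l' → T (n, l) → T (n, l')) ∧
      ∀ n X, X ∈ Cyl (W n) ↔ ∃ s, T (n, res X s) := by
  obtain ⟨q, hq, hmono, hiff⟩ := hW.exists_stages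
  refine ⟨fun x => ∃ j < x.2.length + 1, q ((x.1, x.2.take j), x.2.length), ?_, ?_, ?_⟩
  · exact Pr.ex_lt (p := fun (x : ℕ × List Bool) j => q ((x.1, x.2.take j), x.2.length))
      (by fun_prop) (by fun_prop)
  · rintro n l l' h ⟨j, hj, hqj⟩
    have hl := h.length_le
    refine ⟨j, by dsimp only at hj ⊢; omega, ?_⟩
    obtain ⟨t, rfl⟩ := h
    dsimp only at hj hqj ⊢
    rw [List.take_append_of_le_length (by omega)]
    exact hmono _ _ _ hl hqj
  · intro n X
    simp only [length_res, mem_Cyl]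
    constructor
    · rintro ⟨j, h⟩
      obtain ⟨m, hm⟩ := (hiff (n, res X j)).1 h
      refine ⟨j + m, j, by omega, ?_⟩
      rw [take_res X (by omega)]
      exact hmono _ _ _ (by omega) hm
    · rintro ⟨s, j, hj, h⟩
      rw [take_res X (by omega)] at h
      exact ⟨j, (hiff (n, res X j)).2 ⟨s, h⟩⟩

lemma CE.res_of_primrecPred {T : ℕ × List Bool → Prop} (hT : PrimrecPred T) (X : ℕ → Bool) :
    CE X fun x : ℕ × ℕ => T (x.1, res X x.2) := by
  refine CE.mk' (fun y => y.1.2 ≤ y.2.length ∧ T (y.1.1, y.2.take y.1.2)) (by fun_prop) fun x => ?_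
  constructor
  · intro h
    exact ⟨x.2, by simp, by rw [take_res X le_rfl]; exact h⟩
  · rintro ⟨m, h1, h2⟩
    rw [length_res] at h1
    rwa [take_res X h1] at h2

theorem UAEDominating.aeDominating {B : Set ℕ} (h : UAEDominating B) : AEDominating B := by
  obtain ⟨f, hf, h⟩ := h
  filter_upwards [h] with X hX g hg
  exact ⟨f, hf, hX g hg⟩

theorem AEDominating.pmDominating {B : Set ℕ} (h : AEDominating B) : PMDominating B := by
  rintro P ⟨W, hW, rfl⟩ hpos
  obtain ⟨T, hT, hmono, hiff⟩ := exists_string_stages (ceSeqIn_iff.1 hW)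
  choose code hcode using encodeCode_surjective
  let S : ℕ × ℕ → Set (ℕ → Bool) := fun x => {X | ∃ f : ℕ → ℕ,
    (code x.1).eval (chi B) = ↑f ∧ ∀ n, T (n, res X (max (f n) x.2))}
  have hsub : ∀ᵐ X ∂mu, X ∈ ⋂ n, Cyl (W n) → X ∈ ⋃ x, S x := by
    filter_upwards [h] with X hX hXP
    rw [Set.mem_iInter] at hXP
    obtain ⟨g, hg, hTg⟩ := (CE.res_of_primrecPred hT X).exists_selection
      (p := fun n s => T (n, res X s)) fun n => (hiff n X).1 (hXP n)
    obtain ⟨f, ⟨c, hc⟩, hfg⟩ := hX g hg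
    obtain ⟨N, hN⟩ := eventually_atTop.1 hfg
    refine Set.mem_iUnion.2 ⟨(c.encodeCode, (Finset.range N).sup g), f, ?_, fun n => ?_⟩
    · rw [eval_congr (hcode _), hc]
    · refine hmono _ _ _ (res_prefix X ?_) (hTg n)
      by_cases hn : N ≤ n
      · exact (hN n hn).trans (le_max_left _ _)
      · exact (Finset.le_sup (Finset.mem_range.2 (not_le.1 hn))).trans (le_max_right _ _)
  obtain ⟨⟨e, k⟩, hek⟩ : ∃ x, 0 < mu (S x) := by
    by_contra! h0
    have h1 : mu (⋃ x, S x) = 0 := measure_iUnion_null fun x => le_antisymm (h0 x) bot_le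
    exact hpos.ne' (le_antisymm ((measure_mono_ae hsub).trans h1.le) bot_le)
  obtain ⟨f, hf⟩ : ∃ f : ℕ → ℕ, (code e).eval (chi B) = ↑f := by
    obtain ⟨X, f, hf, -⟩ := nonempty_of_measure_ne_zero hek.ne'
    exact ⟨f, hf⟩
  let V : Set (List Bool) := {σ | ∃ x : ℕ × ℕ, x.2 ∈ (code e).eval (oracleOf (bits B)) x.1 ∧
    max x.2 k ≤ σ.length ∧ ¬ T (x.1, σ.take (max x.2 k))}
  have hV : CE (bits B) (· ∈ V) :=
    CE.ex (p := fun (σ : List Bool) (x : ℕ × ℕ) => x.2 ∈ (code e).eval (oracleOf (bits B)) x.1 ∧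
      max x.2 k ≤ σ.length ∧ ¬ T (x.1, σ.take (max x.2 k)))
      ((CE.eval_eq (by fun_prop) (by fun_prop)).and (CE.prim (by fun_prop)))
  have hVC : ∀ X, X ∈ (Cyl V)ᶜ ↔ ∀ n, T (n, res X (max (f n) k)) := by
    intro X
    rw [Set.mem_compl_iff, mem_Cyl]
    constructor
    · intro h n
      by_contra hT
      refine h ⟨max (f n) k, (n, f n), ?_, by simp, by rwa [take_res X le_rfl]⟩
      rw [oracleOf_bits, hf]
      exact Part.mem_some _
    · rintro h ⟨m, ⟨n, v⟩, h1, h2, h3⟩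
      rw [oracleOf_bits, hf] at h1
      obtain rfl : v = f n := Part.mem_some_iff.1 h1
      rw [length_res] at h2
      rw [take_res X h2] at h3
      exact h3 (h n)
  refine ⟨(Cyl V)ᶜ, ⟨V, ceIn_iff.2 hV, rfl⟩, fun X hX => Set.mem_iInter.2 fun n =>
    (hiff n X).2 ⟨_, (hVC X).1 hX n⟩, hek.trans_le (measure_mono ?_)⟩
  rintro X ⟨f', hf', h⟩
  have : f' = f := by
    funext n
    have := congrFun (hf'.symm.trans hf) n
    exact Part.some_inj.1 this
  subst this
  exact (hVC X).2 h

lemma exists_approx_range_stageIdx :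
    ∃ apx : ℕ × ℕ → Prop, PrimrecPred apx ∧
      (∀ i ∈ Set.range fun x : ℕ × ℕ => stageIdx (jump ∅) x.1 x.2, ∀ᶠ t in atTop, apx (i, t)) ∧
      ∀ i ∉ Set.range fun x : ℕ × ℕ => stageIdx (jump ∅) x.1 x.2, ∀ᶠ t in atTop, ¬ apx (i, t) := by
  obtain ⟨apx, hapx, h1, h2⟩ := exists_approx_jump
  let dc : ℕ → List Bool := fun i => (Encodable.decode (α := List Bool) i.unpair.2).getD []
  have hdc : Primrec dc := by
    have := Primrec.decode (α := List Bool)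
    fun_prop
  have henc := Primrec.encode (α := List Bool)
  refine ⟨fun x => Nat.pair x.1.unpair.1 (Encodable.encode (dc x.1)) = x.1 ∧ apx (dc x.1, x.2),
    by fun_prop, ?_, fun i hi => ?_⟩
  · rintro _ ⟨⟨r, m⟩, rfl⟩
    filter_upwards [h1 m] with t ht
    simp [dc, stageIdx, ht]
  · by_cases hp : Nat.pair i.unpair.1 (Encodable.encode (dc i)) = i
    · filter_upwards [h2 (dc i) fun m hm => hi ⟨(i.unpair.1, m), by
        simp only [stageIdx, ← hm, hp]⟩] with t ht using fun h => ht h.2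
    · exact .of_forall fun t h => hp h.1

theorem PMDominating.lrle {B : Set ℕ} (h : PMDominating B) : LRle (jump ∅) B := by
  rintro X hX U ⟨W, hW, hU, -, hm⟩ hXU
  obtain ⟨K, hK⟩ := exists_stage_sets (W := fun n => W (n + 2))
    ((ceSeqIn_iff.1 hW).comp (f := fun x : ℕ × List Bool => (x.1 + 2, x.2)) (by fun_prop))
  let I : Set ℕ := Set.range fun x : ℕ × ℕ => stageIdx (jump ∅) x.1 x.2
  obtain ⟨apx, hapx, ha1, ha2⟩ := exists_approx_range_stageIdx
  have hbd := K.col.prim_bd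
  have hdec := K.col.prim_dec
  let V : ℕ → Set (List Bool) := fun n => {σ | (K.col.bd n.unpair.1 ≤ σ.length ∧
    ¬ K.col.dec (n.unpair.1, σ.take (K.col.bd n.unpair.1))) ∨
      ∃ t, n.unpair.2 ≤ t ∧ ¬ apx (n.unpair.1, t)}
  have hV : CE (bits ∅) fun x : ℕ × List Bool => x.2 ∈ V x.1 :=
    (CE.prim (p := fun x : ℕ × List Bool => K.col.bd x.1.unpair.1 ≤ x.2.length ∧
        ¬ K.col.dec (x.1.unpair.1, x.2.take (K.col.bd x.1.unpair.1))) (by fun_prop)).or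
      (CE.ex (p := fun (x : ℕ × List Bool) t => x.1.unpair.2 ≤ t ∧ ¬ apx (x.1.unpair.1, t))
        (CE.prim (by fun_prop)))
  have hVC : ⋂ n, Cyl (V n) = (⋃ i ∈ I, K.col.set i)ᶜ := by
    have hV' : ∀ n, Cyl (V n) = (K.col.set n.unpair.1)ᶜ ∪
        {_X | ∃ t, n.unpair.2 ≤ t ∧ ¬ apx (n.unpair.1, t)} := by
      intro n
      rw [Clop.compl_set]
      ext Y
      simp only [V, mem_Cyl, Set.mem_union, Set.mem_ofPred_eq, exists_or, exists_const]
    ext Y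
    simp only [hV', Set.mem_iInter, Set.mem_union, Set.mem_compl_iff, Set.mem_ofPred_eq,
      Set.mem_iUnion, not_exists]
    constructor
    · intro hY i hi hYi
      obtain ⟨s, hs⟩ := eventually_atTop.1 (ha1 i hi)
      have := hY (Nat.pair i s)
      simp only [Nat.unpair_pair] at this
      rcases this with h | ⟨t, ht, h⟩
      · exact h hYi
      · exact h (hs t ht)
    · intro hY n
      by_cases hi : n.unpair.1 ∈ I
      · exact .inl (hY _ hi)
      · exact .inr ((eventually_ge_atTop _).and (ha2 _ hi)).exists
  have hhalf : mu (⋃ i ∈ I, K.col.set i) ≤ 2⁻¹ := by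
    refine (measure_biUnion_le mu (Set.to_countable I) _).trans ?_
    simp_rw [K.mu_col]
    rw [tsum_range_stageIdx (jump ∅) fun i => mu (K.set i)]
    calc ∑' r, ∑' m, mu (K.set (stageIdx (jump ∅) r m)) ≤ ∑' r, 2⁻¹ ^ (r + 2) :=
          ENNReal.tsum_le_tsum fun r => by rw [(hK r).2, ← hU]; exact hm _
      _ = 2⁻¹ := by
          simp_rw [pow_add]
          rw [ENNReal.tsum_mul_right, ENNReal.tsum_geometric, ENNReal.one_sub_inv_two, inv_inv,
            pow_two, ← mul_assoc, ENNReal.mul_inv_cancel (by simp) (by simp), one_mul]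
  have hpos : 0 < mu (⋂ n, Cyl (V n)) := by
    rw [hVC, prob_compl_eq_one_sub (.biUnion (Set.to_countable I) fun i _ => K.col.measurableSet i)]
    refine tsub_pos_of_lt (hhalf.trans_lt (by simp))
  obtain ⟨Q, ⟨Z, hZ, rfl⟩, hQ, hQpos⟩ := h _ ⟨V, ceSeqIn_iff.2 hV, rfl⟩ hpos
  obtain ⟨J, hJ, hJs, hcov⟩ := exists_summable_cover K (ceIn_iff.1 hZ) hQpos
  refine not_mlRandom_of_infinite K hJ hJs (Set.infinite_of_forall_exists_gt fun k => ?_) hX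
  have hXk := Set.mem_iInter.1 hXU (k + 1 + 2)
  rw [hU, ← (hK (k + 1)).1] at hXk
  obtain ⟨m, hm⟩ := Set.mem_iUnion.1 hXk
  refine ⟨_, ⟨hcov (stageIdx (jump ∅) (k + 1) m) ?_, hm⟩, Nat.left_le_pair _ _⟩
  convert measure_empty (μ := mu)
  refine Set.disjoint_iff_inter_eq_empty.1 (Set.disjoint_left.2 fun Y hY hYQ => ?_)
  have := hQ hYQ
  rw [hVC] at this
  exact this (Set.mem_biUnion ⟨(k + 1, m), rfl⟩ hY)

lemma primrec_filter {α β : Type*} [Primcodable α] [Primcodable β] {f : α → List β}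
    {p : α → β → Prop} [∀ a b, Decidable (p a b)]
    (hf : Primrec f) (hp : PrimrecPred fun x : α × β => p x.1 x.2) :
    Primrec fun a => (f a).filter fun b => decide (p a b) := by
  classical
  have hg : Primrec₂ fun a b => if p a b then some b else none := by
    unfold Primrec₂
    exact (Pr.ite hp (Primrec.option_some.comp .snd) (.const none)).of_eq fun x => by congr
  refine (Primrec.listFilterMap hf hg).of_eq fun a => ?_
  rw [← List.filterMap_eq_filter]
  congr 1
  funext b
  by_cases h : p a b <;> simp [Option.guard, h]

/-- If universality of an open set is witnessed by compactness, it is a c.e. property. -/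
lemma CE.cyl_eq_univ {α : Type*} [Primcodable α] {X : ℕ → Bool} {W : α → Set (List Bool)}
    (h : CE X fun x : α × List Bool => x.2 ∈ W x.1) : CE X fun a => Cyl (W a) = Set.univ := by
  refine (CE.ex (p := fun a (y : List (List Bool) × ℕ) => (∀ σ ∈ y.1, σ ∈ W a) ∧
    ∀ τ ∈ strs y.2, ∃ σ ∈ y.1, σ <+: τ) ?_).of_eq fun a => ?_
  · refine CE.and (CE.all_mem (f := fun x : α × List (List Bool) × ℕ => x.2.1)
      (p := fun x σ => σ ∈ W x.1) (by fun_prop)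
      (h.comp (f := fun z : (α × List (List Bool) × ℕ) × List Bool => (z.1.1, z.2))
        (by fun_prop))) (CE.prim ?_)
    exact Pr.all_mem (f := fun x : α × List (List Bool) × ℕ => strs x.2.2)
      (p := fun x τ => ∃ σ ∈ x.2.1, σ <+: τ) (by fun_prop)
      (Pr.ex_mem (f := fun z : (α × List (List Bool) × ℕ) × List Bool => z.1.2.1)
        (p := fun z σ => σ <+: z.2) (by fun_prop) (by fun_prop))
  · constructor
    · rintro ⟨⟨M, L⟩, h1, h2⟩
      refine Set.eq_univ_of_forall fun Y => ?_
      obtain ⟨σ, hσ, hp⟩ := h2 (res Y L) (by simp)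
      exact mem_Cyl.2 ⟨σ.length, by rw [(isPrefix_res_iff.1 hp).1]; exact h1 σ hσ⟩
    · intro hU
      obtain ⟨t, ht⟩ := isCompact_univ.elim_finite_subcover
        (fun σ : W a => {Y : ℕ → Bool | res Y σ.1.length = σ.1}) (fun σ => isOpen_res_eq _ _)
        fun Y _ => by
          obtain ⟨n, hn⟩ := mem_Cyl.1 (hU ▸ Set.mem_univ Y : Y ∈ Cyl (W a))
          exact Set.mem_iUnion.2 ⟨⟨_, hn⟩, by simp⟩
      refine ⟨(t.toList.map Subtype.val, t.sup fun σ => σ.1.length), ?_, fun τ hτ => ?_⟩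
      · intro σ hσ
        obtain ⟨σ', -, rfl⟩ := List.mem_map.1 hσ
        exact σ'.2
      · obtain ⟨Y, hY⟩ := exists_res_eq (l := τ)
        obtain ⟨σ, hσt, hσ⟩ := Set.mem_iUnion₂.1 (ht (Set.mem_univ Y))
        refine ⟨σ, List.mem_map.2 ⟨σ, Finset.mem_toList.2 hσt, rfl⟩, ?_⟩
        rw [← hY, mem_strs.1 hτ]
        exact isPrefix_res_iff.2 ⟨hσ, Finset.le_sup (f := fun σ : W a => σ.1.length) hσt⟩

lemma exists_convergence_stages :
    ∃ d : (ℕ × ℕ) × List Bool → Prop, PrimrecPred d ∧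
      (∀ a l l', l <+: l' → d (a, l) → d (a, l')) ∧
      ∀ (c : OracleCode) (X : ℕ → Bool) (g : ℕ → ℕ), c.eval (oracleOf X) = ↑g →
        ∀ n, (∃ s, d ((c.encodeCode, n), res X s)) ∧
          ∀ s, d ((c.encodeCode, n), res X s) → g n ≤ s := by
  refine ⟨fun x => ∃ b < x.2.length + 1, ∃ v < x.2.length + 1,
    uEval x.2.length (x.2.take b) x.1.1 x.1.2 = some v, ?_, ?_, ?_⟩
  · refine Pr.ex_lt (f := fun x : (ℕ × ℕ) × List Bool => x.2.length + 1)
      (p := fun x b => ∃ v < x.2.length + 1,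
        uEval x.2.length (x.2.take b) x.1.1 x.1.2 = some v) (by fun_prop)
      (Pr.ex_lt (f := fun x : ((ℕ × ℕ) × List Bool) × ℕ => x.1.2.length + 1)
      (p := fun x v => uEval x.1.2.length (x.1.2.take x.2) x.1.1.1 x.1.1.2 = some v)
      (by fun_prop) (Pr.eq (primrec_uEval (by fun_prop) (by fun_prop) (by fun_prop)
        (by fun_prop)) (by fun_prop)))
  · rintro a l l' h ⟨b, hb, v, hv, hu⟩
    have hl := h.length_le
    refine ⟨b, by dsimp only at hb ⊢; omega, v, by dsimp only at hv ⊢; omega, ?_⟩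
    obtain ⟨t, rfl⟩ := h
    dsimp only at hb hu ⊢
    rw [List.take_append_of_le_length (by omega)]
    exact uEval_mono hl hu
  · intro c X g hc n
    simp only [length_res]
    have hg : g n ∈ c.eval (oracleOf X) n := by rw [hc]; exact Part.mem_some _
    constructor
    · obtain ⟨m, s, h⟩ := mem_eval_oracleOf.1 hg
      refine ⟨m + s + g n, m, by omega, g n, by omega, ?_⟩
      rw [take_res X (by omega)]
      exact uEval_mono (by omega) h
    · rintro s ⟨b, hb, v, hv, h⟩
      rw [take_res X (by omega)] at h
      have := Part.mem_unique hg (mem_eval_oracleOf.2 ⟨b, s, h⟩)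
      omega

lemma exists_measure_sdiff_le {D : ℕ → Set (ℕ → Bool)} (hD : ∀ s, MeasurableSet (D s))
    (hmono : Monotone D) {ε : ℝ≥0∞} (hε : 0 < ε) : ∃ s, ∀ t, mu (D t \ D s) ≤ ε := by
  have hanti : Antitone fun s => (⋃ t, D t) \ D s := fun s s' h =>
    Set.sdiff_subset_sdiff_right (hmono h)
  have hlim := tendsto_measure_iInter_atTop (μ := mu)
    (fun s => ((MeasurableSet.iUnion hD).diff (hD s)).nullMeasurableSet) hanti
    ⟨0, measure_ne_top _ _⟩
  rw [show ⋂ s, (⋃ t, D t) \ D s = ∅ by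
    ext X
    simp only [Set.mem_iInter, Set.mem_sdiff, Set.mem_iUnion, Set.mem_empty_iff_false, iff_false,
      not_forall, not_and, not_not]
    by_cases h : ∃ t, X ∈ D t
    · exact h.imp fun t ht _ => ht
    · exact ⟨0, fun h' => absurd h' h⟩, measure_empty] at hlim
  obtain ⟨s, hs⟩ := (hlim.eventually (gt_mem_nhds hε)).exists
  exact ⟨s, fun t =>
    (measure_mono (Set.sdiff_subset_sdiff_left (Set.subset_iUnion D t))).trans hs.le⟩

lemma measure_iUnion_inter_le {D : ℕ → Set (ℕ → Bool)} (hmono : Monotone D) {ε : ℝ≥0∞}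
    {G : Set ℕ} (hG : ∀ s ∈ G, ∀ t, s ≤ t → mu (D t \ D s) ≤ ε) :
    mu ((⋃ t, D t) ∩ ⋃ s ∈ G, (D s)ᶜ) ≤ ε := by
  classical
  by_cases h : ∃ s, s ∈ G
  · have hsub : (⋃ t, D t) ∩ ⋃ s ∈ G, (D s)ᶜ ⊆ ⋃ t, D t \ D (Nat.find h) := by
      rintro X ⟨hX, hX'⟩
      obtain ⟨t, ht⟩ := Set.mem_iUnion.1 hX
      obtain ⟨s, hs, hXs⟩ := Set.mem_iUnion₂.1 hX'
      exact Set.mem_iUnion.2 ⟨t, ht, fun hc => hXs (hmono (Nat.find_min' h hs) hc)⟩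
    refine (measure_mono hsub).trans ?_
    rw [Monotone.measure_iUnion fun t t' h => Set.sdiff_subset_sdiff_left (hmono h)]
    refine iSup_le fun t => ?_
    rcases le_total (Nat.find h) t with ht | ht
    · exact hG _ (Nat.find_spec h) t ht
    · rw [Set.sdiff_eq_empty.2 (hmono ht)]; simp
  · push Not at h
    simp [h]

/-- The set of sequences on which the computation coded by `e` has converged at `n` by stage `s`. -/
def convSet (d : (ℕ × ℕ) × List Bool → Prop) (e n s : ℕ) : Set (ℕ → Bool) :=
  {X | d ((e, n), res X s)}

lemma measurableSet_convSet (d : (ℕ × ℕ) × List Bool → Prop) (e n s : ℕ) :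
    MeasurableSet (convSet d e n s) :=
  measurableSet_res s fun l => d ((e, n), l)

lemma monotone_convSet {d : (ℕ × ℕ) × List Bool → Prop}
    (hmono : ∀ a l l', l <+: l' → d (a, l) → d (a, l')) (e n : ℕ) : Monotone (convSet d e n) :=
  fun _ _ h X hX => hmono _ _ _ (res_prefix X h) hX

/-- The set of total computations is approximated from inside, up to small measure, by
uniformly `Π₁` classes relative to the halting problem. -/
lemma exists_jump_ce_cover {d : (ℕ × ℕ) × List Bool → Prop} (hd : PrimrecPred d)
    (hmono : ∀ a l l', l <+: l' → d (a, l) → d (a, l')) :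
    ∃ W : ℕ → Set (List Bool), (CE (bits (jump ∅)) fun x : ℕ × List Bool => x.2 ∈ W x.1) ∧
      ∀ r, mu ((⋂ n, ⋃ t, convSet d r.unpair.1 n t) ∩ Cyl (W r)) ≤ 2 * 2⁻¹ ^ r ∧
        ∀ n, (Cyl (W r))ᶜ ⊆ ⋃ t, convSet d r.unpair.1 n t := by
  classical
  let N : (ℕ × ℕ × ℕ) × ℕ → List (List Bool) := fun x => (strs x.2).filter fun τ =>
    decide (d ((x.1.1.unpair.1, x.1.2.1), τ) ∧ ¬ d ((x.1.1.unpair.1, x.1.2.1), τ.take x.1.2.2))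
  have hN : Primrec N := primrec_filter (f := fun x : (ℕ × ℕ × ℕ) × ℕ => strs x.2)
    (p := fun x τ => d ((x.1.1.unpair.1, x.1.2.1), τ) ∧
      ¬ d ((x.1.1.unpair.1, x.1.2.1), τ.take x.1.2.2)) (by fun_prop) (by fun_prop)
  have hNmu : ∀ r n s t, s ≤ t →
      mu (convSet d r.unpair.1 n t \ convSet d r.unpair.1 n s) =
        (N ((r, n, s), t)).length * 2⁻¹ ^ t := by
    intro r n s t hst
    rw [← mu_res_mem ((nodup_strs t).filter _) fun l hl =>
      mem_strs.1 (List.mem_of_mem_filter hl)]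
    congr 1
    ext X
    simp [convSet, take_res X hst]
  let bad : (ℕ × ℕ × ℕ) → Prop := fun x => ∃ t, x.2.2 ≤ t ∧
    ¬ (N (x, t)).length * 2 ^ (x.2.1 + x.1) ≤ 2 ^ t
  have hbad : CE (bits ∅) bad := CE.ex (p := fun (x : ℕ × ℕ × ℕ) t => x.2.2 ≤ t ∧
    ¬ (N (x, t)).length * 2 ^ (x.2.1 + x.1) ≤ 2 ^ t) (CE.prim (by fun_prop))
  have hgood : ∀ r n s, ¬ bad (r, n, s) ↔ ∀ t, s ≤ t →
      mu (convSet d r.unpair.1 n t \ convSet d r.unpair.1 n s) ≤ 2⁻¹ ^ (n + r) := by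
    intro r n s
    simp only [bad, not_exists, not_and, not_not]
    exact forall₂_congr fun t ht => by rw [hNmu r n s t ht, natCast_mul_inv_pow_le]
  let W : ℕ → Set (List Bool) := fun r =>
    {σ | ∃ n, ¬ bad (r, n, σ.length) ∧ ¬ d ((r.unpair.1, n), σ)}
  have hWC : ∀ r, Cyl (W r) =
      ⋃ n, ⋃ s ∈ {s | ¬ bad (r, n, s)}, (convSet d r.unpair.1 n s)ᶜ := by
    intro r
    ext X
    simp only [W, mem_Cyl, Set.mem_ofPred_eq, length_res, Set.mem_iUnion, Set.mem_compl_iff,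
      convSet, exists_prop]
    exact exists_comm
  refine ⟨W, ?_, fun r => ⟨?_, fun n X hX => ?_⟩⟩
  · refine CE.ex (p := fun (x : ℕ × List Bool) n => ¬ bad (x.1, n, x.2.length) ∧
      ¬ d ((x.1.unpair.1, n), x.2)) ?_
    exact (hbad.compl_jump.comp (f := fun y : (ℕ × List Bool) × ℕ =>
      (y.1.1, y.2, y.1.2.length)) (by fun_prop)).and (CE.prim (by fun_prop))
  · rw [hWC, Set.inter_iUnion]
    calc _ ≤ ∑' n, mu ((⋂ n, ⋃ t, convSet d r.unpair.1 n t) ∩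
          ⋃ s ∈ {s | ¬ bad (r, n, s)}, (convSet d r.unpair.1 n s)ᶜ) := measure_iUnion_le _
      _ ≤ ∑' n : ℕ, 2⁻¹ ^ (n + r) := by
          refine ENNReal.tsum_le_tsum fun n => (measure_mono (Set.inter_subset_inter_left _
            (Set.iInter_subset _ n))).trans ?_
          exact measure_iUnion_inter_le (monotone_convSet hmono _ n)
            fun s hs => (hgood r n s).1 hs
      _ = 2 * 2⁻¹ ^ r := by
          simp_rw [pow_add]
          rw [ENNReal.tsum_mul_right, ENNReal.tsum_geometric, ENNReal.one_sub_inv_two, inv_inv]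
  · obtain ⟨s, hs⟩ := exists_measure_sdiff_le (measurableSet_convSet d r.unpair.1 n)
      (monotone_convSet hmono _ n) (ε := 2⁻¹ ^ (n + r)) (by simp [pos_iff_ne_zero])
    by_contra hc
    refine hX ?_
    rw [hWC]
    exact Set.mem_iUnion.2 ⟨n, Set.mem_iUnion₂.2 ⟨s, (hgood r n s).2 fun t _ => hs t,
      fun h => hc (Set.mem_iUnion.2 ⟨s, h⟩)⟩⟩

/-- The strings forcing membership in some set of `K` with index in `J`, first component `r` and
approximation true at a stage after `s`. -/
def tailStrs (K : Clop) (J : Set ℕ) (apx : ℕ × ℕ → Prop) (r s : ℕ) : Set (List Bool) :=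
  {σ | ∃ i, i ∈ J ∧ i.unpair.1 = r ∧ (∃ t, s ≤ t ∧ apx (i, t)) ∧ K.bd i ≤ σ.length ∧
    K.dec (i, σ.take (K.bd i))}

lemma mem_Cyl_tailStrs {K : Clop} {J : Set ℕ} {apx : ℕ × ℕ → Prop} {r s : ℕ} {X : ℕ → Bool} :
    X ∈ Cyl (tailStrs K J apx r s) ↔
      ∃ i, i ∈ J ∧ i.unpair.1 = r ∧ (∃ t, s ≤ t ∧ apx (i, t)) ∧ X ∈ K.set i := by
  rw [mem_Cyl]
  constructor
  · rintro ⟨n, i, h1, h2, h3, h4, h5⟩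
    rw [length_res] at h4
    rw [take_res X h4] at h5
    exact ⟨i, h1, h2, h3, h5⟩
  · rintro ⟨i, h1, h2, h3, h4⟩
    exact ⟨K.bd i, i, h1, h2, h3, by simp, by rw [take_res X le_rfl]; exact h4⟩

lemma ce_tailStrs {K : Clop} {J : Set ℕ} {apx : ℕ × ℕ → Prop} {X : ℕ → Bool}
    (hJ : CE X (· ∈ J)) (hapx : PrimrecPred apx) :
    CE X fun x : (ℕ × ℕ) × List Bool => x.2 ∈ tailStrs K J apx x.1.1 x.1.2 := by
  have hbd := K.prim_bd
  have hdec := K.prim_dec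
  refine CE.ex (p := fun (x : (ℕ × ℕ) × List Bool) i => i ∈ J ∧ i.unpair.1 = x.1.1 ∧
    (∃ t, x.1.2 ≤ t ∧ apx (i, t)) ∧ K.bd i ≤ x.2.length ∧ K.dec (i, x.2.take (K.bd i))) ?_
  refine (hJ.comp .snd).and ((CE.prim (by fun_prop)).and ((CE.ex (p := fun
    (y : ((ℕ × ℕ) × List Bool) × ℕ) t => y.1.1.2 ≤ t ∧ apx (y.2, t))
    (CE.prim (by fun_prop))).and (CE.prim (by fun_prop))))

lemma ae_exists_notMem_tailStrs {K : Clop} {W : ℕ → Set (List Bool)} {J : Set ℕ}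
    {apx : ℕ × ℕ → Prop}
    (hK : ∀ r, ⋃ m, K.set (stageIdx (jump ∅) r m) = Cyl (W r))
    (hJ : ∑' i : J, mu (K.shift.set i) ≠ ∞)
    (hapx : ∀ i ∉ Set.range fun x : ℕ × ℕ => stageIdx (jump ∅) x.1 x.2,
      ∀ᶠ t in atTop, ¬ apx (i, t)) :
    ∀ᵐ X ∂mu, ∀ r, X ∉ Cyl (W r) → ∃ s, X ∉ Cyl (tailStrs K J apx r s) := by
  rw [ae_all_iff]
  intro r
  have hsum : ∑' i : {i : J // i.1.unpair.1 = r}, mu (K.set i) ≠ ∞ := by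
    have h : ∑' i : {i : J // i.1.unpair.1 = r}, 2⁻¹ ^ r * mu (K.set i) ≠ ∞ := by
      refine ne_top_of_le_ne_top hJ (le_trans (le_of_eq ?_)
        (ENNReal.tsum_comp_le_tsum_of_injective
          (Subtype.val_injective (p := fun i : J => i.1.unpair.1 = r)) _))
      exact tsum_congr fun i => by rw [Clop.mu_shift, i.2]
    rw [ENNReal.tsum_mul_left] at h
    intro htop
    rw [htop] at h
    exact h (ENNReal.mul_top (by simp))
  filter_upwards [ae_finite_setOfPred_mem hsum] with X hfin hX
  have hev : ∀ i ∈ {i : {i : J // i.1.unpair.1 = r} | X ∈ K.set i},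
      ∀ᶠ t in atTop, ¬ apx (i.1.1, t) := by
    rintro ⟨⟨i, hiJ⟩, hi⟩ hXi
    refine hapx i ?_
    rintro ⟨⟨r', m⟩, rfl⟩
    obtain rfl : r' = r := by simpa [stageIdx] using hi
    exact hX (by rw [← hK]; exact Set.mem_iUnion.2 ⟨m, hXi⟩)
  obtain ⟨s, hs⟩ := eventually_atTop.1 ((hfin.eventually_all).2 hev)
  refine ⟨s, fun h => ?_⟩
  obtain ⟨i, h1, h2, ⟨t, ht, h3⟩, h4⟩ := mem_Cyl_tailStrs.1 h
  exact hs t ht ⟨⟨i, h1⟩, h2⟩ h4 h3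

theorem LRle.uaeDominating {B : Set ℕ} (h : LRle (jump ∅) B) : UAEDominating B := by
  obtain ⟨d, hd, hmono, hconv⟩ := exists_convergence_stages
  obtain ⟨W, hW, hWr⟩ := exists_jump_ce_cover hd hmono
  obtain ⟨K, hK⟩ := exists_stage_sets hW
  obtain ⟨apx, hapx, ha1, ha2⟩ := exists_approx_range_stageIdx
  obtain ⟨J, hJ, hIJ, hJs⟩ := h.exists_cover K.shift (ce_range_stageIdx _) (by
    rw [tsum_range_stageIdx (jump ∅) fun i => mu (K.shift.set i)]
    have : ∑' r, ∑' m, mu (K.shift.set (stageIdx (jump ∅) r m)) ≤ ∑' r, 2⁻¹ ^ r := by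
      refine ENNReal.tsum_le_tsum fun r => ?_
      simp_rw [Clop.mu_shift, show ∀ m, (stageIdx (jump ∅) r m).unpair.1 = r by simp [stageIdx]]
      rw [ENNReal.tsum_mul_left, (hK r).2]
      exact mul_le_of_le_one_right' prob_le_one
    refine ne_top_of_le_ne_top ?_ this
    rw [ENNReal.tsum_geometric, ENNReal.one_sub_inv_two, inv_inv]
    simp)
  let Z : (ℕ × ℕ) × ℕ × ℕ → Set (List Bool) := fun x => tailStrs K J apx x.1.1 x.1.2 ∪
    {σ | x.2.2 ≤ σ.length ∧ d ((x.1.1.unpair.1, x.2.1), σ.take x.2.2)}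
  have hZ : CE (bits B) fun x : ((ℕ × ℕ) × ℕ × ℕ) × List Bool => x.2 ∈ Z x.1 :=
    ((ce_tailStrs hJ hapx).comp (f := fun x : ((ℕ × ℕ) × ℕ × ℕ) × List Bool => (x.1.1, x.2))
      (by fun_prop)).or (CE.prim (by fun_prop : PrimrecPred fun x :
        ((ℕ × ℕ) × ℕ × ℕ) × List Bool => x.1.2.2 ≤ x.2.length ∧
          d ((x.1.1.1.unpair.1, x.1.2.1), x.2.take x.1.2.2)))
  have hZC : ∀ r s n t, Cyl (Z ((r, s), n, t)) =
      Cyl (tailStrs K J apx r s) ∪ convSet d r.unpair.1 n t := by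
    intro r s n t
    simp only [Z]
    rw [Cyl_union]
    congr 1
    ext X
    rw [mem_Cyl]
    constructor
    · rintro ⟨m, h1, h2⟩
      rw [length_res] at h1
      rwa [take_res X h1] at h2
    · intro hX
      exact ⟨t, by simp, by rw [take_res X le_rfl]; exact hX⟩
  have hZmono : ∀ r s n, Monotone fun t => Cyl (Z ((r, s), n, t)) := by
    intro r s n t t' ht
    simp only [hZC]
    exact Set.union_subset_union_right _ (monotone_convSet hmono _ n ht)
  have hZex : ∀ r s n, ∃ t, Cyl (Z ((r, s), n, t)) = Set.univ := by
    intro r s n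
    obtain ⟨t, ht⟩ := isCompact_univ.elim_directed_cover (fun t => Cyl (Z ((r, s), n, t)))
      (fun t => isOpen_Cyl _) (fun X _ => by
        by_cases hX : X ∈ Cyl (W r)
        · rw [← (hK r).1] at hX
          obtain ⟨m, hm⟩ := Set.mem_iUnion.1 hX
          refine Set.mem_iUnion.2 ⟨0, ?_⟩
          rw [hZC]
          refine .inl (mem_Cyl_tailStrs.2 ⟨_, hIJ ⟨(r, m), rfl⟩, by simp [stageIdx], ?_, hm⟩)
          exact ((eventually_ge_atTop s).and (ha1 _ ⟨(r, m), rfl⟩)).exists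
        · obtain ⟨t, ht⟩ := Set.mem_iUnion.1 ((hWr r).2 n hX)
          exact Set.mem_iUnion.2 ⟨t, by rw [hZC]; exact .inr ht⟩)
      (hZmono r s n).directed_le
    exact ⟨t, Set.univ_subset_iff.1 ht⟩
  obtain ⟨f, hf, hfZ⟩ := CE.exists_selection (X := bits B)
    (p := fun n t => ∀ r < n + 1, ∀ s < n + 1, Cyl (Z ((r, s), n, t)) = Set.univ)
    (CE.all_lt (f := fun x : ℕ × ℕ => x.1 + 1)
      (p := fun x r => ∀ s < x.1 + 1, Cyl (Z ((r, s), x.1, x.2)) = Set.univ) (by fun_prop)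
      (CE.all_lt (f := fun y : (ℕ × ℕ) × ℕ => y.1.1 + 1)
        (p := fun y s => Cyl (Z ((y.2, s), y.1.1, y.1.2)) = Set.univ) (by fun_prop)
        (hZ.cyl_eq_univ.comp (f := fun z : ((ℕ × ℕ) × ℕ) × ℕ =>
          ((z.1.2, z.2), z.1.1.1, z.1.1.2)) (by fun_prop))))
    (fun n => by
      choose t ht using fun r s => hZex r s n
      refine ⟨(Finset.range (n + 1)).sup fun r => (Finset.range (n + 1)).sup (t r),
        fun r hr s hs => Set.univ_subset_iff.1 ((ht r s).ge.trans (hZmono r s n ?_))⟩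
      exact (Finset.le_sup (f := t r) (Finset.mem_range.2 hs)).trans
        (Finset.le_sup (f := fun r => (Finset.range (n + 1)).sup (t r)) (Finset.mem_range.2 hr)))
  rw [oracleOf_bits] at hf
  have hnull : ∀ᵐ X ∂mu, ∀ e, X ∈ ⋂ n, ⋃ t, convSet d e n t → ∃ k, X ∉ Cyl (W (Nat.pair e k)) := by
    rw [ae_all_iff]
    intro e
    have h0 : mu ((⋂ n, ⋃ t, convSet d e n t) ∩ ⋂ k, Cyl (W (Nat.pair e k))) = 0 := by
      have hlim : Tendsto (fun k : ℕ => 2 * (2⁻¹ : ℝ≥0∞) ^ k) atTop (nhds (2 * 0)) :=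
        ENNReal.Tendsto.const_mul (ENNReal.tendsto_pow_atTop_nhds_zero_of_lt_one (by simp))
          (by simp)
      rw [mul_zero] at hlim
      refine le_antisymm (ge_of_tendsto' hlim fun k => ?_) bot_le
      have hk := (hWr (Nat.pair e k)).1
      rw [Nat.unpair_pair] at hk
      refine (measure_mono (Set.inter_subset_inter_right _ (Set.iInter_subset _ k))).trans
        (hk.trans ?_)
      refine mul_le_mul' le_rfl ?_
      exact pow_le_pow_right_of_le_one' (ENNReal.inv_le_one.2 one_le_two) (Nat.right_le_pair e k)
    filter_upwards [measure_eq_zero_iff_ae_notMem.1 h0] with X hX hXT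
    by_contra! hc
    exact hX ⟨hXT, Set.mem_iInter.2 hc⟩
  refine ⟨f, hf, ?_⟩
  filter_upwards [hnull, ae_exists_notMem_tailStrs (fun r => (hK r).1) hJs ha2] with X hX1 hX2
  rintro g ⟨c, hc⟩
  have hcg := hconv c X g hc
  obtain ⟨k, hk⟩ := hX1 c.encodeCode
    (Set.mem_iInter.2 fun n => Set.mem_iUnion.2 (hcg n).1)
  obtain ⟨s, hs⟩ := hX2 _ hk
  filter_upwards [eventually_ge_atTop (max (Nat.pair c.encodeCode k) s)] with n hn
  have hXn : X ∈ Cyl (Z ((Nat.pair c.encodeCode k, s), n, f n)) := by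
    rw [hfZ n _ (by omega) s (by omega)]
    trivial
  rw [hZC, Nat.unpair_pair] at hXn
  exact (hcg n).2 _ (hXn.resolve_left hs)

/-- The equivalence of uniform a.e. domination, a.e. domination, positive measure
domination, and `∅′ ≤_LR B`. -/
theorem tfae_domination (B : Set ℕ) :
    List.TFAE
      [ UAEDominating B,
        AEDominating B,
        PMDominating B,
        LRle (jump ∅) B ] := by
  tfae_have 1 → 2 := UAEDominating.aeDominating
  tfae_have 2 → 3 := AEDominating.pmDominating
  tfae_have 3 → 4 := PMDominating.lrle
  tfae_have 4 → 1 := LRle.uaeDominating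
  tfae_finish

end LMD
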